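/- arXiv:2310.13338 — 7 statements merged into one kernel-verified Lean document; each statement's English description precedes it below -/
import Mathlib

section
/- Invariance of the class of initial measures: There exists C̄ > 0 (depending only on f) such that for every C₀ ≥ C̄, every ℰ⋆ ≥ 0 and every t ≥ 0, if the family (μ_N) belongs to M_init(C₀) then the family of pushforwards (φ^t_⋆ μ_N) under the flow also belongs to M_init(C₀). -/
/-!
Statement 5: Invariance of the class `M_init(C₀)` of initial measures under the
flow (Lemma 2.3 of the paper): there is `C̄ > 0`, depending only on `f`, such
that for every `C₀ ≥ C̄`, `ℰ⋆ ≥ 0` and `t ≥ 0`, if `(μ_N) ∈ M_init(C₀)` then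
the pushforwards `(φ^t_⋆ μ_N)` under the flow
`φ^t(z₀,θ) = (z(t,z₀,θ), f^{⌊t/ε⌋}θ)` also belong to `M_init(C₀)`.
-/

open MeasureTheory Filter

noncomputable section

/-- Configuration space: positions and momenta in `ℝ²` for each site of `ℤ/Nℤ`. -/
abbrev Conf (N : ℕ) : Type := (ZMod N → ℝ × ℝ) × (ZMod N → ℝ × ℝ)

/-- The environment space `𝕋^N`. -/
abbrev Env (N : ℕ) : Type := ZMod N → UnitAddCircle

/-- The full state space `Ω_N × 𝕋^N`. -/
abbrev FullState (N : ℕ) : Type := Conf N × Env N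

/-- The rotation `J = [[0,1],[-1,0]]` acting on `ℝ²`. -/
def Jmat (v : ℝ × ℝ) : ℝ × ℝ := (v.2, -v.1)

/-- Squared euclidean norm on `ℝ²`. -/
def sqnorm (v : ℝ × ℝ) : ℝ := v.1 ^ 2 + v.2 ^ 2

/-- Single particle energy. -/
def siteEnergy (ω0 : ℝ) {N : ℕ} (z : Conf N) (x : ZMod N) : ℝ :=
  sqnorm (z.2 x) / 2 + sqnorm (z.1 x - z.1 (x - 1)) / 2 + ω0 ^ 2 * sqnorm (z.1 x) / 2

/-- Total energy `ℰ_N`. -/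
def totalEnergy (ω0 : ℝ) {N : ℕ} (z : Conf N) : ℝ :=
  ∑ i : Fin N, siteEnergy ω0 z ((i : ℕ) : ZMod N)

/-- `Z : ℝ → Conf N` solves the chain dynamics with environment `θ ∈ 𝕋^N`. -/
def IsSolutionC (ω0 ε : ℝ) {N : ℕ} (bc : UnitAddCircle → ℝ)
    (fc : UnitAddCircle → UnitAddCircle) (θ : Env N)
    (z0 : Conf N) (Z : ℝ → Conf N) : Prop :=
  Z 0 = z0 ∧ Continuous Z ∧
  ∀ t : ℝ, 0 ≤ t → (∀ k : ℕ, t ≠ (k : ℝ) * ε) → ∀ x : ZMod N,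
    HasDerivAt (fun s => (Z s).1 x) ((Z t).2 x) t ∧
    HasDerivAt (fun s => (Z s).2 x)
      ((Z t).1 (x + 1) + (Z t).1 (x - 1) - (2 + ω0 ^ 2) • (Z t).1 x
        + ((Real.sqrt ε)⁻¹ * bc (fc^[⌊t / ε⌋₊] (θ x))) • Jmat ((Z t).2 x)) t

/-- The class `M_init(C₀)` of families of initial measures. -/
def MInitFamily (ω0 C0 Estar : ℝ)
    (μ : (N : ℕ) → Measure (FullState N)) : Prop :=
  (∀ (N : ℕ) [NeZero N], IsProbabilityMeasure (μ N)) ∧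
  (∀ (N : ℕ) [NeZero N],
     ∃ ρ : ZMod N → ℝ → ℝ,
       ∃ hper : ∀ x, Function.Periodic (ρ x) 1,
         (∀ x, ContDiff ℝ 1 (ρ x)) ∧
         (∀ x u, 0 < ρ x u) ∧
         (∀ x u, |deriv (ρ x) u| ≤ C0 * ρ x u) ∧
         (μ N).map Prod.snd
           = MeasureTheory.volume.withDensity
               (fun θ : Env N => ENNReal.ofReal (∏ x : ZMod N, (hper x).lift (θ x)))) ∧
  (∀ (N : ℕ) [NeZero N], (∫ w, totalEnergy ω0 w.1 ∂(μ N)) ≤ Estar * N)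

/-- The time-`t` flow map on the full state space:
`φ^t(z₀,θ) = (z(t,z₀,θ), f^{⌊t/ε⌋}θ)`. -/
def flowMap (ε : ℝ) {N : ℕ} (fc : UnitAddCircle → UnitAddCircle)
    (Z : ℝ → FullState N → Conf N) (t : ℝ) (w : FullState N) : FullState N :=
  (Z t w, fun x => fc^[⌊t / ε⌋₊] (w.2 x))

theorem totalEnergy_eq_sum (ω0 : ℝ) {N : ℕ} [NeZero N] (z : Conf N) :
    totalEnergy ω0 z = ∑ x : ZMod N, siteEnergy ω0 z x := by
  obtain ⟨n, rfl⟩ := Nat.exists_eq_succ_of_ne_zero (NeZero.ne N)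
  exact Finset.sum_congr (Finset.ext fun _ => iff_of_true (Finset.mem_univ _) (Finset.mem_univ _)) fun i _ =>
    congrArg _ (Fin.cast_val_eq_self i)

theorem continuous_totalEnergy (ω0 : ℝ) (N : ℕ) :
    Continuous (totalEnergy ω0 : Conf N → ℝ) := by
  unfold totalEnergy siteEnergy sqnorm
  fun_prop

theorem HasDerivAt.sqnorm {u : ℝ → ℝ × ℝ} {u' : ℝ × ℝ} {t : ℝ} (hu : HasDerivAt u u' t) :
    HasDerivAt (fun s => sqnorm (u s)) (2 * ((u t).1 * u'.1 + (u t).2 * u'.2)) t := by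
  have h1 : HasDerivAt (fun s => (u s).1) u'.1 t := by
    simpa using hu.hasFDerivAt.fst.hasDerivAt
  have h2 : HasDerivAt (fun s => (u s).2) u'.2 t := by
    simpa using hu.hasFDerivAt.snd.hasDerivAt
  refine ((h1.pow 2).add (h2.pow 2)).congr_deriv ?_
  push_cast
  ring

theorem hasDerivAt_sum_siteEnergy_zero {ω0 t : ℝ} {N : ℕ} [NeZero N] {Z : ℝ → Conf N}
    (β : ZMod N → ℝ)
    (hq : ∀ x, HasDerivAt (fun s => (Z s).1 x) ((Z t).2 x) t)
    (hp : ∀ x, HasDerivAt (fun s => (Z s).2 x)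
      ((Z t).1 (x + 1) + (Z t).1 (x - 1) - (2 + ω0 ^ 2) • (Z t).1 x
        + β x • Jmat ((Z t).2 x)) t) :
    HasDerivAt (fun s => ∑ x, siteEnergy ω0 (Z s) x) 0 t := by
  let h : ZMod N → ℝ := fun x =>
    ((Z t).2 x).1 * (((Z t).1 (x + 1)).1 - ((Z t).1 x).1) +
    ((Z t).2 x).2 * (((Z t).1 (x + 1)).2 - ((Z t).1 x).2)
  have hsum : ∑ x, (h x - h (x - 1)) = 0 := by
    rw [Finset.sum_sub_distrib, sub_eq_zero]
    exact ((Equiv.subRight (1 : ZMod N)).sum_comp h).symm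
  rw [← hsum]
  refine HasDerivAt.fun_sum fun x _ => ?_
  refine ((((hp x).sqnorm.div_const 2).add
    (((hq x).sub (hq (x - 1))).sqnorm.div_const 2)).add
    (((hq x).sqnorm.const_mul (ω0 ^ 2)).div_const 2)).congr_deriv ?_
  simp only [h, Jmat, Prod.fst_add, Prod.fst_sub, Prod.snd_add, Prod.snd_sub, Prod.smul_fst,
    Prod.smul_snd, smul_eq_mul, sub_add_cancel, Pi.sub_apply]
  ring

theorem IsSolutionC.totalEnergy_eq {ω0 ε : ℝ} {N : ℕ} [NeZero N] {bc : UnitAddCircle → ℝ}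
    {fc : UnitAddCircle → UnitAddCircle} {θ : Env N} {z0 : Conf N} {Z : ℝ → Conf N}
    (hZ : IsSolutionC ω0 ε bc fc θ z0 Z) {t : ℝ} (ht : 0 ≤ t) :
    totalEnergy ω0 (Z t) = totalEnergy ω0 z0 := by
  obtain ⟨h0, hcont, hder⟩ := hZ
  have key := integral_eq_of_hasDerivAt_off_countable_of_le
    (fun s => totalEnergy ω0 (Z s)) (fun _ => 0) ht
    (Set.countable_range fun k : ℕ => (k : ℝ) * ε)
    ((continuous_totalEnergy ω0 N).comp hcont).continuousOn
    (fun s hs => by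
      have hs' : ∀ k : ℕ, s ≠ (k : ℝ) * ε := fun k hk => hs.2 ⟨k, hk.symm⟩
      simp only [totalEnergy_eq_sum]
      exact hasDerivAt_sum_siteEnergy_zero _
        (fun x => (hder s hs.1.1.le hs' x).1) (fun x => (hder s hs.1.1.le hs' x).2))
    (by simp)
  simp only [intervalIntegral.integral_zero, h0] at key
  linarith

theorem pi_withDensity_ofReal {ι : Type*} [Fintype ι] {α : ι → Type*}
    [∀ i, MeasurableSpace (α i)] (μ : ∀ i, Measure (α i)) [∀ i, SigmaFinite (μ i)]
    {r : ∀ i, α i → ℝ} (hr : ∀ i a, 0 ≤ r i a) (hint : ∀ i, Integrable (r i) (μ i)) :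
    Measure.pi (fun i => (μ i).withDensity fun a => ENNReal.ofReal (r i a)) =
      (Measure.pi μ).withDensity fun a => ENNReal.ofReal (∏ i, r i (a i)) := by
  have (i : ι) : SigmaFinite ((μ i).withDensity fun a => ENNReal.ofReal (r i a)) :=
    SigmaFinite.withDensity_of_ne_top (by simp)
  refine Measure.pi_eq fun s hs => ?_
  have hints (i : ι) : Integrable (r i) ((μ i).restrict (s i)) := (hint i).restrict
  rw [withDensity_apply _ (.univ_pi hs), Measure.restrict_pi_pi,
    ← ofReal_integral_eq_lintegral_ofReal (Integrable.fintype_prod_dep hints)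
      (.of_forall fun a => Finset.prod_nonneg fun i _ => hr i _),
    integral_fintype_prod_eq_prod,
    ENNReal.ofReal_prod_of_nonneg fun i _ => integral_nonneg (hr i)]
  refine Finset.prod_congr rfl fun i _ => ?_
  rw [withDensity_apply _ (hs i),
    ofReal_integral_eq_lintegral_ofReal (hints i) (.of_forall (hr i))]

theorem lintegral_Ioc_zero_natCast (h : ℝ → ENNReal) (n : ℕ) :
    ∫⁻ x in Set.Ioc (0 : ℝ) n, h x =
      ∑ k ∈ Finset.range n, ∫⁻ x in Set.Ioc (0 : ℝ) 1, h (x + k) := by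
  induction n with
  | zero => simp
  | succ n ih =>
    have hU : Set.Ioc (0 : ℝ) (n + 1 : ℕ) = Set.Ioc 0 (n : ℝ) ∪ Set.Ioc (n : ℝ) (n + 1) := by
      rw [Set.Ioc_union_Ioc_eq_Ioc (by positivity) (by linarith)]
      push_cast; rfl
    have himg : Set.Ioc (n : ℝ) (n + 1) = (fun x : ℝ => x + n) '' Set.Ioc 0 1 := by
      simp [add_comm]
    rw [hU, lintegral_union measurableSet_Ioc (Set.Ioc_disjoint_Ioc_of_le le_rfl), ih,
      Finset.sum_range_succ, himg]
    congr 1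
    exact (measurePreserving_add_right volume (n : ℝ)).setLIntegral_comp_emb
      (measurableEmbedding_addRight _) h _ |>.symm

theorem Function.Periodic.deriv {g : ℝ → ℝ} {c : ℝ} (hg : Function.Periodic g c) :
    Function.Periodic (deriv g) c := fun x => by
  rw [← deriv_comp_add_const]
  congr 1
  exact funext hg

theorem Function.Periodic.exists_abs_le_of_continuous {g : ℝ → ℝ} (hg : Function.Periodic g 1)
    (hc : Continuous g) : ∃ K, 0 ≤ K ∧ ∀ x, |g x| ≤ K := by
  obtain ⟨K, hK⟩ := isCompact_Icc.exists_bound_of_continuousOn (s := Set.Icc (0 : ℝ) 1)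
    hc.continuousOn
  have h (x : ℝ) : |g x| ≤ K := by
    obtain ⟨y, hy, hxy⟩ := hg.exists_mem_Ico₀ one_pos x
    rw [hxy]
    exact hK y (Set.Ico_subset_Icc_self hy)
  exact ⟨K, (abs_nonneg _).trans (h 0), h⟩

/-- `ν` has a positive `C¹` density on the circle whose logarithmic derivative is bounded by
`C`. -/
def HasLogLipDensity (C : ℝ) (ν : Measure UnitAddCircle) : Prop :=
  ∃ ρ : ℝ → ℝ, ∃ hper : Function.Periodic ρ 1, ContDiff ℝ 1 ρ ∧ (∀ u, 0 < ρ u) ∧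
    (∀ u, |deriv ρ u| ≤ C * ρ u) ∧
    ν = volume.withDensity fun θ => ENNReal.ofReal (hper.lift θ)

theorem Function.Periodic.continuous_lift {ρ : ℝ → ℝ} (hper : Function.Periodic ρ 1)
    (hρ : Continuous ρ) : Continuous (hper.lift : UnitAddCircle → ℝ) :=
  continuous_quot_lift _ hρ

theorem Function.Periodic.lift_pos {ρ : ℝ → ℝ} (hper : Function.Periodic ρ 1)
    (hρ : ∀ u, 0 < ρ u) (θ : UnitAddCircle) : 0 < hper.lift θ := by
  induction θ using QuotientAddGroup.induction_on with
  | H u => exact hρ u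

theorem exists_hasDerivAt_rightInverse {F : ℝ → ℝ} (hF : Differentiable ℝ F) {lam : ℝ}
    (hlam : 0 < lam) (hexp : ∀ x, lam ≤ deriv F x) :
    ∃ G : ℝ → ℝ, (∀ x, F (G x) = x) ∧ (∀ x, G (F x) = x) ∧
      ∀ x, HasDerivAt G (deriv F (G x))⁻¹ x := by
  have hmono : StrictMono F := strictMono_of_deriv_pos fun x => hlam.trans_le (hexp x)
  have hgrow {x y : ℝ} (hxy : x ≤ y) : lam * (y - x) ≤ F y - F x :=
    mul_sub_le_image_sub_of_le_deriv hF hexp hxy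
  have hsurj : Function.Surjective F := by
    refine hF.continuous.surjective ?_ ?_
    · refine tendsto_atTop_mono' atTop (f₁ := fun x => lam * x + F 0) ?_ ?_
      · filter_upwards [eventually_ge_atTop 0] with x hx
        linarith [hgrow hx]
      · exact tendsto_atTop_add_const_right _ _ (tendsto_id.const_mul_atTop hlam)
    · refine tendsto_atBot_mono' atBot (f₁ := fun x => lam * x + F 0) ?_ ?_
      · filter_upwards [eventually_le_atBot 0] with x hx
        linarith [hgrow hx]
      · exact tendsto_atBot_add_const_right _ _ (tendsto_id.const_mul_atBot hlam)
  let e := hmono.orderIsoOfSurjective F hsurj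
  have hFG : ∀ x, F (e.symm x) = x := e.apply_symm_apply
  exact ⟨e.symm, hFG, e.symm_apply_apply, fun x =>
    (hF _).hasDerivAt.of_local_left_inverse e.symm.continuous.continuousAt
      (hlam.trans_le (hexp _)).ne' (.of_forall hFG)⟩

theorem HasLogLipDensity.map_of_expanding {F : ℝ → ℝ} (hF : ContDiff ℝ 2 F) {n : ℕ} (hn : n ≠ 0)
    (hFlift : ∀ x, F (x + 1) = F x + n) {lam : ℝ} (hlam : 1 < lam) (hexp : ∀ x, lam ≤ deriv F x)
    {fc : UnitAddCircle → UnitAddCircle}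
    (hfc : ∀ x : ℝ, fc (x : UnitAddCircle) = ((F x : ℝ) : UnitAddCircle)) (hfcm : Measurable fc)
    {K C : ℝ} (hK : ∀ x, |deriv (deriv F) x| ≤ K) (hKC : C / lam + K ≤ C)
    {ν : Measure UnitAddCircle} (hν : HasLogLipDensity C ν) :
    HasLogLipDensity C (ν.map fc) := by
  obtain ⟨ρ, hper, hρ, hpos, hbd, rfl⟩ := hν
  have hlam0 : 0 < lam := one_pos.trans hlam
  have hF' (x : ℝ) : 0 < deriv F x := hlam0.trans_le (hexp x)
  have hFd : Differentiable ℝ F := hF.differentiable (by norm_num)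
  have hdF : ContDiff ℝ 1 (deriv F) := ((contDiff_succ_iff_deriv (n := 1)).1 hF).2.2
  obtain ⟨G, hFG, hGF, hG⟩ := exists_hasDerivAt_rightInverse hFd hlam0 hexp
  have hGshift (x : ℝ) : G (x + n) = G x + 1 := by rw [← hGF (G x + 1), hFlift, hFG]
  have hFper : Function.Periodic (deriv F) 1 := fun x => by
    rw [← deriv_comp_add_const]
    simp [hFlift]
  have hG1 : ContDiff ℝ 1 G := by
    refine contDiff_one_iff_deriv.2 ⟨fun x => (hG x).differentiableAt, ?_⟩
    rw [funext fun x => (hG x).deriv]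
    exact (hdF.continuous.comp (continuous_iff_continuousAt.2 fun x => (hG x).continuousAt)).inv₀
      fun x => (hF' _).ne'
  let g : ℝ → ℝ := fun x => ρ (G x) / deriv F (G x)
  have hgpos (x : ℝ) : 0 < g x := div_pos (hpos _) (hF' _)
  have hg1 : ContDiff ℝ 1 g := (hρ.comp hG1).div (hdF.comp hG1) fun x => (hF' _).ne'
  have hgper (x : ℝ) : g (x + n) = g x := by
    simp only [g, hGshift, hper (G x), hFper (G x)]
  have hgbd (x : ℝ) : |deriv g x| ≤ C * g x := by
    have hd := (((hρ.differentiable one_ne_zero (G x)).hasDerivAt.div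
      (hdF.differentiable one_ne_zero (G x)).hasDerivAt (hF' _).ne').comp x (hG x)).deriv
    have hd' : deriv g x = deriv ρ (G x) / deriv F (G x) * (deriv F (G x))⁻¹ -
        g x * (deriv (deriv F) (G x) * (deriv F (G x))⁻¹ * (deriv F (G x))⁻¹) := by
      refine hd.trans ?_
      have := (hF' (G x)).ne'
      simp only [g]
      field_simp
    have hinv : (deriv F (G x))⁻¹ ≤ lam⁻¹ := inv_anti₀ hlam0 (hexp _)
    have hinv0 : 0 < (deriv F (G x))⁻¹ := inv_pos.2 (hF' _)
    have hinv1 : (deriv F (G x))⁻¹ ≤ 1 := hinv.trans (inv_le_one_of_one_le₀ hlam.le)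
    have hCg : |deriv ρ (G x) / deriv F (G x)| ≤ C * g x := by
      rw [abs_div, abs_of_pos (hF' _), ← mul_div_assoc]
      exact div_le_div_of_nonneg_right (hbd _) (hF' _).le
    have h1 : |deriv ρ (G x) / deriv F (G x) * (deriv F (G x))⁻¹| ≤ C * g x * lam⁻¹ := by
      rw [abs_mul, abs_of_pos hinv0]
      exact mul_le_mul hCg hinv hinv0.le ((abs_nonneg _).trans hCg)
    have h2 : |g x * (deriv (deriv F) (G x) * (deriv F (G x))⁻¹ * (deriv F (G x))⁻¹)| ≤
        g x * K := by
      rw [abs_mul, abs_of_pos (hgpos x), abs_mul, abs_mul, abs_of_pos hinv0]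
      have hK0 : 0 ≤ K := (abs_nonneg _).trans (hK 0)
      refine mul_le_mul_of_nonneg_left ?_ (hgpos x).le
      calc _ ≤ K * 1 * 1 := by gcongr; exact hK _
        _ = K := by ring
    calc |deriv g x| ≤ C * g x * lam⁻¹ + g x * K := by
          rw [hd']; exact (abs_sub _ _).trans (add_le_add h1 h2)
      _ = (C / lam + K) * g x := by ring
      _ ≤ C * g x := mul_le_mul_of_nonneg_right hKC (hgpos x).le
  have hLper : Function.Periodic (fun u => ∑ k ∈ Finset.range n, g (u + k)) 1 := fun u => by
    have h1 := Finset.sum_range_succ (fun k : ℕ => g (u + k)) n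
    have h2 := Finset.sum_range_succ' (fun k : ℕ => g (u + k)) n
    simp only [hgper, Nat.cast_zero, add_zero] at h1 h2
    have h3 := add_right_cancel (h1.symm.trans h2)
    simp only [h3]
    exact Finset.sum_congr rfl fun k _ => congrArg g (by push_cast; ring)
  have hL1 : ContDiff ℝ 1 (fun u => ∑ k ∈ Finset.range n, g (u + k)) :=
    ContDiff.sum fun k _ => hg1.comp (contDiff_id.add contDiff_const)
  refine ⟨_, hLper, hL1,
    fun u => Finset.sum_pos (fun k _ => hgpos _) (Finset.nonempty_range_iff.2 hn), fun u => ?_, ?_⟩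
  · have hd : deriv (fun u => ∑ k ∈ Finset.range n, g (u + k)) u =
        ∑ k ∈ Finset.range n, deriv g (u + k) := by
      refine (HasDerivAt.fun_sum fun k _ => ?_).deriv
      exact ((hg1.differentiable one_ne_zero _).hasDerivAt).comp_add_const u k
    rw [hd, Finset.mul_sum]
    exact (Finset.abs_sum_le_sum_abs _ _).trans (Finset.sum_le_sum fun k _ => hgbd _)
  · have hlm : Measurable fun θ : UnitAddCircle => ENNReal.ofReal (hper.lift θ) :=
      (hper.continuous_lift hρ.continuous).measurable.ennreal_ofReal
    have hLm : Measurable fun θ : UnitAddCircle => ENNReal.ofReal (hLper.lift θ) :=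
      (hLper.continuous_lift hL1.continuous).measurable.ennreal_ofReal
    have hmono : StrictMono F := strictMono_of_deriv_pos hF'
    have himg : F '' Set.Ioc (G 0) (G 0 + 1) = Set.Ioc 0 (n : ℝ) := by
      have hGmono : StrictMono G := fun a b hab => by rwa [← hmono.lt_iff_lt, hFG, hFG]
      rw [← hGshift, zero_add]
      ext x
      constructor
      · rintro ⟨y, hy, rfl⟩
        rw [← hGF y] at hy
        exact ⟨hGmono.lt_iff_lt.1 hy.1, hGmono.le_iff_le.1 hy.2⟩
      · exact fun hx => ⟨G x, ⟨hGmono hx.1, hGmono.monotone hx.2⟩, hFG x⟩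
    refine Measure.ext_of_lintegral _ fun h hh => ?_
    have hhfc : Measurable fun θ => h (fc θ) := hh.comp hfcm
    rw [lintegral_map hh hfcm, lintegral_withDensity_eq_lintegral_mul _ hlm hhfc,
      lintegral_withDensity_eq_lintegral_mul _ hLm hh,
      ← UnitAddCircle.lintegral_preimage (G 0), ← UnitAddCircle.lintegral_preimage 0, zero_add]
    simp only [Pi.mul_apply, hfc, Function.Periodic.lift_coe]
    calc ∫⁻ u in Set.Ioc (G 0) (G 0 + 1), ENNReal.ofReal (ρ u) * h (F u : ℝ)
        = ∫⁻ u in Set.Ioc (G 0) (G 0 + 1), ENNReal.ofReal |deriv F u| *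
            (ENNReal.ofReal (g (F u)) * h (F u : ℝ)) := by
          refine lintegral_congr fun u => ?_
          rw [← mul_assoc, ← ENNReal.ofReal_mul (abs_nonneg _), abs_of_pos (hF' u)]
          simp only [g, hGF]
          rw [mul_div_cancel₀ _ (hF' u).ne']
      _ = ∫⁻ x in Set.Ioc 0 (n : ℝ), ENNReal.ofReal (g x) * h (x : ℝ) := by
          rw [← himg]
          exact (lintegral_image_eq_lintegral_abs_deriv_mul measurableSet_Ioc
            (fun x _ => (hFd x).hasDerivAt.hasDerivWithinAt) hmono.injective.injOn
            fun x => ENNReal.ofReal (g x) * h (x : ℝ)).symm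
      _ = ∑ k ∈ Finset.range n, ∫⁻ x in Set.Ioc (0 : ℝ) 1,
            ENNReal.ofReal (g (x + k)) * h (x : ℝ) := by
          rw [lintegral_Ioc_zero_natCast]
          have hcoe (x : ℝ) (k : ℕ) : ((x + k : ℝ) : UnitAddCircle) = x := by
            rw [AddCircle.coe_add, ← nsmul_one (A := ℝ) k, AddCircle.coe_nsmul,
              AddCircle.coe_period, nsmul_zero, add_zero]
          simp only [hcoe]
      _ = ∫⁻ x in Set.Ioc (0 : ℝ) 1,
            ENNReal.ofReal (∑ k ∈ Finset.range n, g (x + k)) * h (x : ℝ) := by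
          rw [← lintegral_finsetSum]
          · refine lintegral_congr fun x => ?_
            rw [ENNReal.ofReal_sum_of_nonneg fun k _ => (hgpos _).le, Finset.sum_mul]
          · intro k _
            exact ((hg1.continuous.comp (continuous_add_const _)).measurable.ennreal_ofReal).mul
              (hh.comp AddCircle.measurable_mk')

theorem HasLogLipDensity.map_iterate {C : ℝ} {fc : UnitAddCircle → UnitAddCircle}
    (hfcm : Measurable fc)
    (hstep : ∀ ν, HasLogLipDensity C ν → HasLogLipDensity C (ν.map fc))
    {ν : Measure UnitAddCircle} (hν : HasLogLipDensity C ν) (m : ℕ) :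
    HasLogLipDensity C (ν.map fc^[m]) := by
  induction m with
  | zero => simpa using hν
  | succ m ih =>
    rw [Function.iterate_succ', ← Measure.map_map hfcm (hfcm.iterate m)]
    exact hstep _ ih

theorem pi_eq_withDensity_lift {ι : Type*} [Fintype ι] {ρ : ι → ℝ → ℝ}
    (hper : ∀ i, Function.Periodic (ρ i) 1) (hρ : ∀ i, Continuous (ρ i))
    (hpos : ∀ i u, 0 < ρ i u) :
    Measure.pi (fun i => (volume : Measure UnitAddCircle).withDensity fun θ =>
        ENNReal.ofReal ((hper i).lift θ)) =
      volume.withDensity fun θ : ι → UnitAddCircle =>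
        ENNReal.ofReal (∏ i, (hper i).lift (θ i)) :=
  pi_withDensity_ofReal _ (fun i θ => ((hper i).lift_pos (hpos i) θ).le) fun i =>
    ((hper i).continuous_lift (hρ i)).integrable_of_hasCompactSupport
      (HasCompactSupport.of_compactSpace _)

theorem exists_bound_preserving_hasLogLipDensity
    {F : ℝ → ℝ} (hF : ContDiff ℝ 2 F) {d : ℤ} (hFlift : ∀ x, F (x + 1) = F x + d)
    {lam : ℝ} (hlam : 1 < lam) (hexp : ∀ x, lam ≤ deriv F x)
    {fc : UnitAddCircle → UnitAddCircle}
    (hfc : ∀ x : ℝ, fc (x : UnitAddCircle) = ((F x : ℝ) : UnitAddCircle)) (hfcm : Measurable fc) :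
    ∃ Cbar : ℝ, 0 < Cbar ∧ ∀ C, Cbar ≤ C →
      ∀ ν, HasLogLipDensity C ν → HasLogLipDensity C (ν.map fc) := by
  have hlam0 : 0 < lam := one_pos.trans hlam
  have hmono : StrictMono F := strictMono_of_deriv_pos fun x => hlam0.trans_le (hexp x)
  have hd : 0 < d := by
    have := hmono (lt_add_one (0 : ℝ))
    rw [hFlift] at this
    exact_mod_cast (lt_add_iff_pos_right _).1 this
  lift d to ℕ using hd.le
  have hdF : ContDiff ℝ 1 (deriv F) := ((contDiff_succ_iff_deriv (n := 1)).1 hF).2.2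
  have hFper : Function.Periodic (deriv F) 1 := fun x => by
    rw [← deriv_comp_add_const]
    simp [hFlift]
  obtain ⟨K, hK0, hK⟩ := hFper.deriv.exists_abs_le_of_continuous (hdF.continuous_deriv le_rfl)
  have hlam1 : 0 < lam - 1 := sub_pos.2 hlam
  refine ⟨(K + 1) * lam / (lam - 1), by positivity, fun C hC ν hν => ?_⟩
  refine hν.map_of_expanding hF (n := d) (by omega) (by simpa using hFlift) hlam hexp hfc hfcm hK ?_
  rw [div_le_iff₀ hlam1] at hC
  rw [← le_sub_iff_add_le', ← mul_le_mul_iff_of_pos_right hlam0, sub_mul,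
    div_mul_cancel₀ _ hlam0.ne']
  linarith

/-- **Invariance of `M_init(C₀)` under the flow** (Lemma 2.3). -/
theorem minit_invariant_under_flow
    (ω0 : ℝ) (hω0 : 0 < ω0)
    (F : ℝ → ℝ) (hF : ContDiff ℝ (⊤ : ℕ∞) F) (d : ℤ) (hFlift : ∀ x, F (x + 1) = F x + d)
    (lam : ℝ) (hlam : 1 < lam) (hexp : ∀ x, lam ≤ deriv F x)
    (fc : UnitAddCircle → UnitAddCircle)
    (hfc : ∀ x : ℝ, fc (x : UnitAddCircle) = ((F x : ℝ) : UnitAddCircle))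
    (hfcm : Measurable fc)
    (b : ℝ → ℝ) (hb : ContDiff ℝ (⊤ : ℕ∞) b) (hbper : Function.Periodic b 1)
    (bc : UnitAddCircle → ℝ) (hbc : ∀ x : ℝ, bc (x : UnitAddCircle) = b x) :
    ∃ Cbar : ℝ, 0 < Cbar ∧
      ∀ (C0 : ℝ), Cbar ≤ C0 →
      ∀ (Estar : ℝ), 0 ≤ Estar →
      ∀ (ε : ℕ → ℝ), (∀ N, 0 < ε N) →
      ∀ (Z : (N : ℕ) → ℝ → FullState N → Conf N),
        (∀ (N : ℕ) (w : FullState N),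
            IsSolutionC ω0 (ε N) bc fc w.2 w.1 (fun t => Z N t w)) →
        (∀ (N : ℕ) (t : ℝ), Measurable (Z N t)) →
      ∀ (t : ℝ), 0 ≤ t →
      ∀ (μ : (N : ℕ) → Measure (FullState N)), MInitFamily ω0 C0 Estar μ →
        MInitFamily ω0 C0 Estar
          (fun N => (μ N).map (flowMap (ε N) fc (Z N) t)) := by
  obtain ⟨Cbar, hCbar, hstep⟩ := exists_bound_preserving_hasLogLipDensity
    (contDiff_infty.1 hF 2) hFlift hlam hexp hfc hfcm
  refine ⟨Cbar, hCbar, fun C0 hC0 Estar _ ε _ Z hZ hZm t ht μ ⟨hprob, hdens, hener⟩ => ?_⟩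
  have hiter (N : ℕ) : Measurable fun (θ : Env N) x => fc^[⌊t / ε N⌋₊] (θ x) :=
    measurable_pi_lambda _ fun x => (hfcm.iterate _).comp (measurable_pi_apply x)
  have hflow (N : ℕ) : Measurable (flowMap (ε N) fc (Z N) t) :=
    (hZm N t).prodMk ((hiter N).comp measurable_snd)
  refine ⟨fun N _ => ?_, fun N _ => ?_, fun N _ => ?_⟩
  · have := hprob N
    exact Measure.isProbabilityMeasure_map (hflow N).aemeasurable
  · obtain ⟨ρ, hper, hρ, hpos, hbd, hmap⟩ := hdens N
    have hmarg (x : ZMod N) := HasLogLipDensity.map_iterate hfcm (hstep C0 hC0)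
      ⟨ρ x, hper x, hρ x, hpos x, hbd x, rfl⟩ ⌊t / ε N⌋₊
    choose ρ' hper' hρ' hpos' hbd' hmap' using hmarg
    refine ⟨ρ', hper', hρ', hpos', hbd', ?_⟩
    have hsf (x : ZMod N) : SigmaFinite (((volume : Measure UnitAddCircle).withDensity
        fun θ => ENNReal.ofReal ((hper x).lift θ)).map fc^[⌊t / ε N⌋₊]) := by
      rw [hmap' x]
      exact SigmaFinite.withDensity_of_ne_top (by simp)
    have hcomp : (Prod.snd ∘ flowMap (ε N) fc (Z N) t) =
        (fun (θ : Env N) x => fc^[⌊t / ε N⌋₊] (θ x)) ∘ Prod.snd := rfl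
    rw [Measure.map_map measurable_snd (hflow N), hcomp,
      ← Measure.map_map (hiter N) measurable_snd, hmap,
      ← pi_eq_withDensity_lift hper (fun x => (hρ x).continuous) hpos,
      ← pi_eq_withDensity_lift hper' (fun x => (hρ' x).continuous) hpos',
      Measure.pi_map_pi fun x => (hfcm.iterate _).aemeasurable]
    exact congrArg Measure.pi (funext hmap')
  · have hcont : Continuous fun w : FullState N => totalEnergy ω0 w.1 :=
      (continuous_totalEnergy ω0 N).comp continuous_fst
    beta_reduce
    rw [integral_map (hflow N).aemeasurable hcont.aestronglyMeasurable]
    simpa only [flowMap, (hZ N _).totalEnergy_eq ht] using hener N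

end
end

section
/- The generator preserves the class of functions controlled by the energy: There exists a constant C (depending only on ω₀ and γ) such that for every sequence A = (A_N) ∈ 𝔈 of degree-two polynomials controlled by the energy, the sequence (𝒢A_N) also belongs to 𝔈 and ‖𝒢A‖_𝔈 ≤ C ‖A‖_𝔈. -/
/-!
Statement 8: The generator `𝒢 = 𝒜 + γ𝒮` preserves the class `𝔈` of sequences of
degree-two polynomials controlled by the energy, with `‖𝒢A‖_𝔈 ≤ C ‖A‖_𝔈`
(Lemma 4.1 of the paper).
-/

open MeasureTheory

noncomputable section

/-- Squared euclidean norm on `ℝ^{4N}`. -/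
def confNormSq {N : ℕ} (z : Conf N) : ℝ :=
  ∑ i : Fin N, (sqnorm (z.1 ((i : ℕ) : ZMod N)) + sqnorm (z.2 ((i : ℕ) : ZMod N)))

/-- A degree-two polynomial observable on `Ω_N`: a constant plus a linear form
plus a symmetric quadratic form. -/
structure QuadObs (N : ℕ) where
  const : ℝ
  lin : Conf N →ₗ[ℝ] ℝ
  quad : Conf N →ₗ[ℝ] Conf N →ₗ[ℝ] ℝ
  symm : ∀ v w, quad v w = quad w v

/-- Evaluation of a degree-two polynomial observable. -/
def QuadObs.eval {N : ℕ} (A : QuadObs N) (z : Conf N) : ℝ :=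
  A.const + A.lin z + A.quad z z

/-- Directional derivative `⟨DA(z), v⟩` of a degree-two observable. -/
def QuadObs.dirDeriv {N : ℕ} (A : QuadObs N) (z v : Conf N) : ℝ :=
  A.lin v + 2 * A.quad z v

/-- Euclidean norm `‖DA(z)‖` of the gradient of a degree-two observable. -/
def QuadObs.gradNorm {N : ℕ} (A : QuadObs N) (z : Conf N) : ℝ :=
  sSup ((fun v => |A.dirDeriv z v|) '' {v : Conf N | confNormSq v = 1})

/-- Operator norm `‖D²A‖` of the (constant) Hessian of a degree-two observable. -/
def QuadObs.hessNorm {N : ℕ} (A : QuadObs N) : ℝ :=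
  sSup ((fun vw : Conf N × Conf N => |2 * A.quad vw.1 vw.2|) ''
    {vw : Conf N × Conf N | confNormSq vw.1 = 1 ∧ confNormSq vw.2 = 1})

/-- A sequence of degree-two observables is controlled by the energy with
constant `K` if `|A_N| ≤ K E`, `‖DA_N‖ ≤ K √E`, `‖D²A_N‖ ≤ K` on every
energy shell `Σ_N(E)`, uniformly in `N` and `E > 0`. -/
def controlledBound (ω0 : ℝ) (A : ∀ N : ℕ, QuadObs N) (K : ℝ) : Prop :=
  ∀ (N : ℕ) (z : Conf N), 0 < totalEnergy ω0 z →
    |(A N).eval z| ≤ K * totalEnergy ω0 z ∧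
    (A N).gradNorm z ≤ K * Real.sqrt (totalEnergy ω0 z) ∧
    (A N).hessNorm ≤ K

/-- The norm `‖A‖_𝔈`: the least constant controlling `A` by the energy. -/
def enNorm (ω0 : ℝ) (A : ∀ N : ℕ, QuadObs N) : ℝ :=
  sInf {K : ℝ | 0 ≤ K ∧ controlledBound ω0 A K}

/-- The drift vector field of `𝒜`: `(p, Δq - ω₀² q)`. -/
def driftField (ω0 : ℝ) {N : ℕ} (z : Conf N) : Conf N :=
  (fun x => z.2 x,
   fun x => z.1 (x + 1) + z.1 (x - 1) - (2 + ω0 ^ 2) • z.1 x)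

/-- The rotation vector field at site `x`: `(0, δ_x J p_x)`. -/
def rotField {N : ℕ} (x : ZMod N) (z : Conf N) : Conf N :=
  (0, fun y => if y = x then Jmat (z.2 x) else 0)

/-- The generator `𝒢 = 𝒜 + γ𝒮`, where
`𝒜 = ∑_x (p_x ∂_{q_x} + (Δq_x - ω₀² q_x) ∂_{p_x})` and
`𝒮 = ∑_x (J p_x · ∂_{p_x})²`, evaluated on a degree-two observable. -/
def generator (ω0 γ : ℝ) {N : ℕ} (A : QuadObs N) (z : Conf N) : ℝ :=
  A.dirDeriv z (driftField ω0 z)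
    + γ * ∑ i : Fin N,
        (2 * A.quad (rotField ((i : ℕ) : ZMod N) z) (rotField ((i : ℕ) : ZMod N) z)
          + A.dirDeriv z (rotField ((i : ℕ) : ZMod N) (rotField ((i : ℕ) : ZMod N) z)))

/-! ### Sums over the discrete torus -/

theorem sum_fin_cast_zmod {M : Type*} [AddCommMonoid M] (N : ℕ) [NeZero N] (f : ZMod N → M) :
    ∑ i : Fin N, f ((i : ℕ) : ZMod N) = ∑ x : ZMod N, f x := by
  obtain ⟨n, rfl⟩ := Nat.exists_eq_succ_of_ne_zero (NeZero.ne N)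
  exact Finset.sum_congr rfl fun i _ => congrArg f (Fin.cast_val_eq_self i)

theorem sum_zmod_sub_one {N : ℕ} [NeZero N] (f : ZMod N → ℝ) :
    ∑ x : ZMod N, f (x - 1) = ∑ x, f x :=
  Equiv.sum_comp (Equiv.subRight (1 : ZMod N)) f

theorem sum_zmod_add_one {N : ℕ} [NeZero N] (f : ZMod N → ℝ) :
    ∑ x : ZMod N, f (x + 1) = ∑ x, f x :=
  Equiv.sum_comp (Equiv.addRight (1 : ZMod N)) f

/-! ### The euclidean norm and the energy -/

theorem sqnorm_nonneg (v : ℝ × ℝ) : 0 ≤ sqnorm v := by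
  unfold sqnorm; positivity

@[simp] theorem sqnorm_zero : sqnorm 0 = 0 := by simp [sqnorm]

theorem sqnorm_eq_zero {v : ℝ × ℝ} (h : sqnorm v = 0) : v = 0 := by
  unfold sqnorm at h
  ext
  · simpa using (by nlinarith [sq_nonneg v.1, sq_nonneg v.2] : v.1 ^ 2 = 0)
  · simpa using (by nlinarith [sq_nonneg v.1, sq_nonneg v.2] : v.2 ^ 2 = 0)

theorem sqnorm_sub_le (v w : ℝ × ℝ) : sqnorm (v - w) ≤ 2 * sqnorm v + 2 * sqnorm w := by
  simp only [sqnorm, Prod.fst_sub, Prod.snd_sub]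
  nlinarith [sq_nonneg (v.1 + w.1), sq_nonneg (v.2 + w.2)]

theorem sqnorm_laplacian_le (a : ℝ) (u v w : ℝ × ℝ) :
    sqnorm (u + v - a • w) ≤ 3 * (sqnorm u + sqnorm v + a ^ 2 * sqnorm w) := by
  simp only [sqnorm, Prod.fst_sub, Prod.snd_sub, Prod.fst_add, Prod.snd_add, Prod.smul_fst,
    Prod.smul_snd, smul_eq_mul]
  nlinarith [sq_nonneg (u.1 - v.1), sq_nonneg (u.2 - v.2), sq_nonneg (u.1 + a * w.1),
    sq_nonneg (u.2 + a * w.2), sq_nonneg (v.1 + a * w.1), sq_nonneg (v.2 + a * w.2)]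

theorem confNormSq_eq_sum {N : ℕ} [NeZero N] (z : Conf N) :
    confNormSq z = ∑ x, sqnorm (z.1 x) + ∑ x, sqnorm (z.2 x) := by
  rw [confNormSq, sum_fin_cast_zmod N fun x => sqnorm (z.1 x) + sqnorm (z.2 x),
    Finset.sum_add_distrib]

theorem confNormSq_nonneg {N : ℕ} (z : Conf N) : 0 ≤ confNormSq z :=
  Finset.sum_nonneg fun _ _ => add_nonneg (sqnorm_nonneg _) (sqnorm_nonneg _)

theorem confNormSq_eq_zero {N : ℕ} [NeZero N] {z : Conf N} (h : confNormSq z = 0) : z = 0 := by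
  have h1 : 0 ≤ ∑ x, sqnorm (z.1 x) := Finset.sum_nonneg fun _ _ => sqnorm_nonneg _
  have h2 : 0 ≤ ∑ x, sqnorm (z.2 x) := Finset.sum_nonneg fun _ _ => sqnorm_nonneg _
  rw [confNormSq_eq_sum] at h
  have h1' : ∑ x, sqnorm (z.1 x) = 0 := by linarith
  have h2' : ∑ x, sqnorm (z.2 x) = 0 := by linarith
  rw [Finset.sum_eq_zero_iff_of_nonneg fun _ _ => sqnorm_nonneg _] at h1' h2'
  exact Prod.ext (funext fun x => sqnorm_eq_zero (h1' x (Finset.mem_univ x)))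
    (funext fun x => sqnorm_eq_zero (h2' x (Finset.mem_univ x)))

theorem confNormSq_smul {N : ℕ} (a : ℝ) (z : Conf N) :
    confNormSq (a • z) = a ^ 2 * confNormSq z := by
  simp only [confNormSq, Finset.mul_sum, sqnorm, Prod.smul_fst, Prod.smul_snd, Pi.smul_apply,
    smul_eq_mul]
  exact Finset.sum_congr rfl fun _ _ => by ring

theorem confNormSq_parallelogram {N : ℕ} (v w : Conf N) :
    confNormSq (v + w) + confNormSq (v - w) = 2 * confNormSq v + 2 * confNormSq w := by
  simp only [confNormSq, Finset.mul_sum, ← Finset.sum_add_distrib, sqnorm, Prod.fst_add,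
    Prod.snd_add, Prod.fst_sub, Prod.snd_sub, Pi.add_apply, Pi.sub_apply]
  exact Finset.sum_congr rfl fun _ _ => by ring

theorem totalEnergy_smul (ω0 a : ℝ) {N : ℕ} (z : Conf N) :
    totalEnergy ω0 (a • z) = a ^ 2 * totalEnergy ω0 z := by
  simp only [totalEnergy, siteEnergy, Finset.mul_sum, sqnorm, Prod.smul_fst, Prod.smul_snd,
    Pi.smul_apply, smul_eq_mul, Prod.fst_sub, Prod.snd_sub]
  exact Finset.sum_congr rfl fun _ _ => by ring

theorem totalEnergy_eq_sum_s8 (ω0 : ℝ) {N : ℕ} [NeZero N] (z : Conf N) :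
    totalEnergy ω0 z = (∑ x, sqnorm (z.2 x)) / 2 + (∑ x, sqnorm (z.1 x - z.1 (x - 1))) / 2
      + ω0 ^ 2 * (∑ x, sqnorm (z.1 x)) / 2 := by
  rw [totalEnergy, sum_fin_cast_zmod N (siteEnergy ω0 z)]
  simp only [siteEnergy, Finset.sum_add_distrib, Finset.mul_sum, Finset.sum_div]

theorem totalEnergy_le_confNormSq (ω0 : ℝ) {N : ℕ} [NeZero N] (z : Conf N) :
    totalEnergy ω0 z ≤ (2 + ω0 ^ 2) * confNormSq z := by
  have h1 : 0 ≤ ∑ x, sqnorm (z.1 x) := Finset.sum_nonneg fun _ _ => sqnorm_nonneg _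
  have h2 : 0 ≤ ∑ x, sqnorm (z.2 x) := Finset.sum_nonneg fun _ _ => sqnorm_nonneg _
  have h3 : ∑ x, sqnorm (z.1 x - z.1 (x - 1)) ≤ 4 * ∑ x, sqnorm (z.1 x) := by
    calc ∑ x, sqnorm (z.1 x - z.1 (x - 1))
        ≤ ∑ x, (2 * sqnorm (z.1 x) + 2 * sqnorm (z.1 (x - 1))) :=
          Finset.sum_le_sum fun x _ => sqnorm_sub_le _ _
      _ = 4 * ∑ x, sqnorm (z.1 x) := by
          rw [Finset.sum_add_distrib, ← Finset.mul_sum, ← Finset.mul_sum,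
            sum_zmod_sub_one fun x => sqnorm (z.1 x)]
          ring
  rw [totalEnergy_eq_sum_s8, confNormSq_eq_sum]
  nlinarith [mul_nonneg (sq_nonneg ω0) h1, mul_nonneg (sq_nonneg ω0) h2]

theorem confNormSq_le_totalEnergy {ω0 : ℝ} (hω0 : 0 < ω0) {N : ℕ} [NeZero N] (z : Conf N) :
    confNormSq z ≤ 2 * (1 + (ω0 ^ 2)⁻¹) * totalEnergy ω0 z := by
  have h1 : 0 ≤ ∑ x, sqnorm (z.1 x) := Finset.sum_nonneg fun _ _ => sqnorm_nonneg _
  have h2 : 0 ≤ ∑ x, sqnorm (z.2 x) := Finset.sum_nonneg fun _ _ => sqnorm_nonneg _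
  have h3 : 0 ≤ ∑ x, sqnorm (z.1 x - z.1 (x - 1)) := Finset.sum_nonneg fun _ _ => sqnorm_nonneg _
  have hi : 0 < (ω0 ^ 2)⁻¹ := by positivity
  have hc : (ω0 ^ 2)⁻¹ * ω0 ^ 2 = 1 := inv_mul_cancel₀ (by positivity)
  rw [totalEnergy_eq_sum_s8, confNormSq_eq_sum]
  have e : (ω0 ^ 2)⁻¹ * (ω0 ^ 2 * ∑ x, sqnorm (z.1 x)) = ∑ x, sqnorm (z.1 x) := by
    rw [← mul_assoc, hc, one_mul]
  have h4 := mul_nonneg hi.le h2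
  have h5 := mul_nonneg hi.le h3
  have h6 := mul_nonneg (sq_nonneg ω0) h1
  linarith

/-! ### Symmetric forms bounded by the euclidean norm -/

theorem QuadObs.abs_quad_le {N : ℕ} (A : QuadObs N) {M : ℝ}
    (hA : ∀ z, |A.quad z z| ≤ M * confNormSq z) (v w : Conf N) :
    |A.quad v w| ≤ M * (confNormSq v + confNormSq w) / 2 := by
  have h4 : 4 * A.quad v w = A.quad (v + w) (v + w) - A.quad (v - w) (v - w) := by
    simp only [map_add, map_sub, LinearMap.add_apply, LinearMap.sub_apply, A.symm w v]
    ring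
  have hp := congrArg (M * ·) (confNormSq_parallelogram v w)
  have h1 := abs_le.1 (hA (v + w))
  have h2 := abs_le.1 (hA (v - w))
  rw [abs_le]
  constructor <;> linarith [h1.1, h1.2, h2.1, h2.2]

theorem QuadObs.abs_quad_le_sqrt {N : ℕ} (A : QuadObs N) {M : ℝ}
    (hA : ∀ z, |A.quad z z| ≤ M * confNormSq z) {z v : Conf N} (hz : 0 < confNormSq z)
    (hv : confNormSq v = 1) : |A.quad z v| ≤ M * √(confNormSq z) := by
  have hs : 0 < √(confNormSq z) := Real.sqrt_pos.2 hz
  have hss : √(confNormSq z) ^ 2 = confNormSq z := Real.sq_sqrt hz.le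
  have h := A.abs_quad_le hA z (√(confNormSq z) • v)
  rw [map_smul, smul_eq_mul, abs_mul, abs_of_pos hs, confNormSq_smul, hv, hss] at h
  refine le_of_mul_le_mul_left ?_ hs
  linear_combination h - M * hss

/-- A homogeneous quadratic observable bounded by the euclidean norm is controlled by the energy. -/
theorem QuadObs.controlled_of_abs_quad_le {ω0 : ℝ} (hω0 : 0 < ω0) {N : ℕ} [NeZero N]
    (A : QuadObs N) {M : ℝ} (hM : 0 ≤ M) (hconst : A.const = 0) (hlin : ∀ z, A.lin z = 0)
    (hA : ∀ z, |A.quad z z| ≤ M * confNormSq z) {z : Conf N} (hz : 0 < totalEnergy ω0 z) :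
    |A.eval z| ≤ 2 * (1 + 2 * (1 + (ω0 ^ 2)⁻¹)) * M * totalEnergy ω0 z ∧
    A.gradNorm z ≤ 2 * (1 + 2 * (1 + (ω0 ^ 2)⁻¹)) * M * √(totalEnergy ω0 z) ∧
    A.hessNorm ≤ 2 * (1 + 2 * (1 + (ω0 ^ 2)⁻¹)) * M := by
  have hle := confNormSq_le_totalEnergy hω0 z
  have hc : 0 ≤ 2 * (1 + (ω0 ^ 2)⁻¹) := by positivity
  set c := 2 * (1 + (ω0 ^ 2)⁻¹)
  have hMc : 0 ≤ M * c := mul_nonneg hM hc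
  have hzpos : 0 < confNormSq z := by
    by_contra h
    have : totalEnergy ω0 z ≤ (2 + ω0 ^ 2) * 0 :=
      (totalEnergy_le_confNormSq ω0 z).trans
        (mul_le_mul_of_nonneg_left (not_lt.1 h) (by positivity))
    linarith
  refine ⟨?_, ?_, ?_⟩
  · rw [QuadObs.eval, hconst, hlin, zero_add, zero_add]
    calc |A.quad z z| ≤ M * confNormSq z := hA z
      _ ≤ M * (c * totalEnergy ω0 z) := by gcongr
      _ ≤ 2 * (1 + c) * M * totalEnergy ω0 z := by nlinarith
  · have hsqrt : √(confNormSq z) ≤ (1 + c) * √(totalEnergy ω0 z) := by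
      rw [Real.sqrt_le_left (by positivity), mul_pow, Real.sq_sqrt hz.le]
      nlinarith [mul_nonneg hc hz.le, mul_nonneg (mul_nonneg hc hc) hz.le]
    refine Real.sSup_le ?_ (by positivity)
    rintro _ ⟨v, hv, rfl⟩
    simp only [QuadObs.dirDeriv, hlin, zero_add, abs_mul, abs_two]
    calc 2 * |A.quad z v| ≤ 2 * (M * √(confNormSq z)) := by
          gcongr; exact A.abs_quad_le_sqrt hA hzpos hv
      _ ≤ 2 * (M * ((1 + c) * √(totalEnergy ω0 z))) := by gcongr
      _ = 2 * (1 + c) * M * √(totalEnergy ω0 z) := by ring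
  · refine Real.sSup_le ?_ (by positivity)
    rintro _ ⟨⟨v, w⟩, ⟨hv, hw⟩, rfl⟩
    simp only at hv hw
    have h := A.abs_quad_le hA v w
    rw [hv, hw] at h
    simp only [abs_mul, abs_two]
    nlinarith

/-- An observable whose values are controlled by the energy is a homogeneous quadratic form. -/
theorem QuadObs.homogeneous_of_abs_eval_le {ω0 : ℝ} {N : ℕ} (A : QuadObs N) {K : ℝ}
    (hA : ∀ z, 0 < totalEnergy ω0 z → |A.eval z| ≤ K * totalEnergy ω0 z) {z : Conf N}
    (hz : 0 < totalEnergy ω0 z) : A.const = 0 ∧ A.lin z = 0 := by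
  have key : ∀ t : ℝ, t ≠ 0 →
      |A.const + t * A.lin z + t ^ 2 * A.quad z z| ≤ t ^ 2 * (K * totalEnergy ω0 z) := by
    intro t ht
    have h := hA (t • z) (by rw [totalEnergy_smul]; positivity)
    simp only [QuadObs.eval, map_smul, LinearMap.smul_apply, smul_eq_mul, totalEnergy_smul] at h
    convert h using 1 <;> ring_nf
  have hlim : ∀ f : ℝ → ℝ, Continuous f →
      Filter.Tendsto f (nhdsWithin 0 (Set.Ioi 0)) (nhds (f 0)) := fun f hf =>
    hf.continuousAt.tendsto.mono_left nhdsWithin_le_nhds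
  have hconst : A.const = 0 := by
    have h := le_of_tendsto_of_tendsto
      (hlim (fun t => |A.const + t * A.lin z + t ^ 2 * A.quad z z|) (by fun_prop))
      (hlim (fun t => t ^ 2 * (K * totalEnergy ω0 z)) (by fun_prop))
      (Filter.eventually_of_mem self_mem_nhdsWithin fun t ht => key t (ne_of_gt ht))
    simpa using h
  refine ⟨hconst, ?_⟩
  have h := le_of_tendsto_of_tendsto
    (hlim (fun t => |A.lin z + t * A.quad z z|) (by fun_prop))
    (hlim (fun t => t * (K * totalEnergy ω0 z)) (by fun_prop))
    (Filter.eventually_of_mem self_mem_nhdsWithin fun t ht => by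
      have ht' : 0 < t := ht
      have h := key t ht'.ne'
      rw [hconst, show 0 + t * A.lin z + t ^ 2 * A.quad z z = t * (A.lin z + t * A.quad z z) by
        ring, abs_mul, abs_of_pos ht'] at h
      refine le_of_mul_le_mul_left (h.trans_eq ?_) ht'
      ring)
  simpa using h

/-! ### The vector fields as linear maps -/

/-- The drift vector field as a linear map. -/
def driftLinear (ω0 : ℝ) (N : ℕ) : Conf N →ₗ[ℝ] Conf N where
  toFun := driftField ω0
  map_add' v w := by
    ext x <;> simp [driftField] <;> ring
  map_smul' a v := by
    ext x <;> simp [driftField] <;> ring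

/-- The rotation vector field at a site as a linear map. -/
def rotLinear {N : ℕ} (x : ZMod N) : Conf N →ₗ[ℝ] Conf N where
  toFun := rotField x
  map_add' v w := by
    ext y <;> by_cases h : y = x <;> simp [rotField, Jmat, h, add_comm]
  map_smul' a v := by
    ext y <;> by_cases h : y = x <;> simp [rotField, Jmat, h]

@[simp] theorem driftLinear_apply (ω0 : ℝ) {N : ℕ} (z : Conf N) :
    driftLinear ω0 N z = driftField ω0 z := rfl

@[simp] theorem rotLinear_apply {N : ℕ} (x : ZMod N) (z : Conf N) :
    rotLinear x z = rotField x z := rfl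

theorem confNormSq_driftField_le (ω0 : ℝ) {N : ℕ} [NeZero N] (z : Conf N) :
    confNormSq (driftField ω0 z) ≤ 3 * (2 + (2 + ω0 ^ 2) ^ 2) * confNormSq z := by
  have h1 : 0 ≤ ∑ x, sqnorm (z.1 x) := Finset.sum_nonneg fun _ _ => sqnorm_nonneg _
  have h2 : 0 ≤ ∑ x, sqnorm (z.2 x) := Finset.sum_nonneg fun _ _ => sqnorm_nonneg _
  have h3 : ∑ x, sqnorm (z.1 (x + 1) + z.1 (x - 1) - (2 + ω0 ^ 2) • z.1 x)
      ≤ 3 * (2 + (2 + ω0 ^ 2) ^ 2) * ∑ x, sqnorm (z.1 x) := by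
    refine (Finset.sum_le_sum fun x _ => sqnorm_laplacian_le _ _ _ _).trans_eq ?_
    rw [← Finset.mul_sum, Finset.sum_add_distrib, Finset.sum_add_distrib, ← Finset.mul_sum,
      sum_zmod_sub_one fun x => sqnorm (z.1 x), sum_zmod_add_one fun x => sqnorm (z.1 x)]
    ring
  rw [confNormSq_eq_sum, confNormSq_eq_sum, mul_add]
  change ∑ x, sqnorm (z.2 x) + ∑ x, sqnorm (z.1 (x + 1) + z.1 (x - 1) - (2 + ω0 ^ 2) • z.1 x) ≤ _
  have h4 := mul_nonneg (sq_nonneg (2 + ω0 ^ 2)) h2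
  linarith

theorem confNormSq_rotField {N : ℕ} [NeZero N] (x : ZMod N) (z : Conf N) :
    confNormSq (rotField x z) = sqnorm (z.2 x) := by
  rw [confNormSq_eq_sum, Finset.sum_eq_single_of_mem (f := fun y => sqnorm ((rotField x z).2 y)) x
    (Finset.mem_univ x) fun y _ hy => by simp [rotField, hy]]
  simp [rotField, Jmat, sqnorm, add_comm]

theorem sum_rotField_rotField {N : ℕ} [NeZero N] (z : Conf N) :
    ∑ x, rotField x (rotField x z) = (0, -z.2) := by
  refine Prod.ext ?_ (funext fun y => ?_)
  · simp [rotField, Prod.fst_sum]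
  · rw [Prod.snd_sum, Finset.sum_apply,
      Finset.sum_eq_single_of_mem y (Finset.mem_univ y)
        fun x _ hx => by simp [rotField, hx.symm]]
    ext <;> simp [rotField, Jmat]

/-! ### The generator -/

/-- The image of a degree-two observable under the generator. -/
def QuadObs.generate (ω0 γ : ℝ) {N : ℕ} (A : QuadObs N) : QuadObs N where
  const := 0
  lin := A.lin ∘ₗ driftLinear ω0 N
    + γ • ∑ i : Fin N, A.lin ∘ₗ rotLinear ((i : ℕ) : ZMod N) ∘ₗ rotLinear ((i : ℕ) : ZMod N)
  quad := A.quad.compl₂ (driftLinear ω0 N) + A.quad ∘ₗ driftLinear ω0 N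
    + γ • ∑ i : Fin N,
      ((2 : ℝ) • A.quad.compl₁₂ (rotLinear ((i : ℕ) : ZMod N)) (rotLinear ((i : ℕ) : ZMod N))
        + A.quad.compl₂ (rotLinear ((i : ℕ) : ZMod N) ∘ₗ rotLinear ((i : ℕ) : ZMod N))
        + A.quad ∘ₗ rotLinear ((i : ℕ) : ZMod N) ∘ₗ rotLinear ((i : ℕ) : ZMod N))
  symm v w := by
    simp only [LinearMap.add_apply, LinearMap.smul_apply, LinearMap.sum_apply,
      LinearMap.compl₂_apply, LinearMap.compl₁₂_apply, LinearMap.comp_apply]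
    congr 1
    · rw [A.symm v, A.symm (driftLinear ω0 N v), add_comm]
    · refine congrArg _ (Finset.sum_congr rfl fun i _ => ?_)
      rw [A.symm v, A.symm _ w, A.symm (rotLinear _ v) (rotLinear _ w), add_right_comm]

theorem QuadObs.generate_quad_self (ω0 γ : ℝ) {N : ℕ} (A : QuadObs N) (z : Conf N) :
    (A.generate ω0 γ).quad z z = 2 * A.quad z (driftField ω0 z)
      + γ * ∑ i : Fin N,
        (2 * A.quad (rotField ((i : ℕ) : ZMod N) z) (rotField ((i : ℕ) : ZMod N) z)
          + 2 * A.quad z (rotField ((i : ℕ) : ZMod N) (rotField ((i : ℕ) : ZMod N) z))) := by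
  simp only [QuadObs.generate, LinearMap.add_apply, LinearMap.smul_apply, LinearMap.sum_apply,
    LinearMap.compl₂_apply, LinearMap.compl₁₂_apply, LinearMap.comp_apply, smul_eq_mul,
    driftLinear_apply, rotLinear_apply]
  congr 1
  · rw [A.symm (driftField ω0 z)]; ring
  · refine congrArg _ (Finset.sum_congr rfl fun i _ => ?_)
    rw [A.symm _ z]; ring

theorem QuadObs.eval_generate (ω0 γ : ℝ) {N : ℕ} (A : QuadObs N) (z : Conf N) :
    (A.generate ω0 γ).eval z = generator ω0 γ A z := by
  rw [QuadObs.eval, generate_quad_self]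
  simp only [QuadObs.generate, generator, QuadObs.dirDeriv, LinearMap.add_apply,
    LinearMap.smul_apply, LinearMap.sum_apply, LinearMap.comp_apply, smul_eq_mul,
    driftLinear_apply, rotLinear_apply, Finset.sum_add_distrib]
  ring

theorem QuadObs.abs_generate_quad_self_le {ω0 γ : ℝ} (hγ : 0 < γ) {N : ℕ} [NeZero N]
    (A : QuadObs N) {M : ℝ} (hM : 0 ≤ M) (hA : ∀ z, |A.quad z z| ≤ M * confNormSq z)
    (z : Conf N) :
    |(A.generate ω0 γ).quad z z|
      ≤ (1 + 3 * (2 + (2 + ω0 ^ 2) ^ 2) + 4 * γ) * M * confNormSq z := by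
  have hp : ∑ x, sqnorm (z.2 x) ≤ confNormSq z := by
    rw [confNormSq_eq_sum]
    exact le_add_of_nonneg_left (Finset.sum_nonneg fun _ _ => sqnorm_nonneg _)
  have hp' : confNormSq ((0, -z.2) : Conf N) ≤ confNormSq z := by
    refine le_trans (le_of_eq ?_) hp
    rw [confNormSq_eq_sum]
    simp [sqnorm]
  have hdrift : |2 * A.quad z (driftField ω0 z)|
      ≤ (1 + 3 * (2 + (2 + ω0 ^ 2) ^ 2)) * M * confNormSq z := by
    have h := A.abs_quad_le hA z (driftField ω0 z)
    have h' := mul_le_mul_of_nonneg_left (confNormSq_driftField_le ω0 z) hM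
    rw [abs_mul, abs_two]
    linarith
  have hdiag : |∑ x, A.quad (rotField x z) (rotField x z)| ≤ M * confNormSq z := by
    calc |∑ x, A.quad (rotField x z) (rotField x z)|
        ≤ ∑ x, |A.quad (rotField x z) (rotField x z)| := Finset.abs_sum_le_sum_abs _ _
      _ ≤ ∑ x, M * sqnorm (z.2 x) :=
          Finset.sum_le_sum fun x _ => (hA _).trans_eq (by rw [confNormSq_rotField])
      _ ≤ M * confNormSq z := by
          rw [← Finset.mul_sum]; gcongr
  have hsnd : |∑ x, A.quad z (rotField x (rotField x z))| ≤ M * confNormSq z := by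
    rw [← map_sum, sum_rotField_rotField]
    have h := A.abs_quad_le hA z (0, -z.2)
    have h' := mul_le_mul_of_nonneg_left hp' hM
    linarith
  rw [generate_quad_self, sum_fin_cast_zmod N fun x =>
    2 * A.quad (rotField x z) (rotField x z) + 2 * A.quad z (rotField x (rotField x z)),
    Finset.sum_add_distrib, ← Finset.mul_sum, ← Finset.mul_sum]
  have hrot : |2 * ∑ x, A.quad (rotField x z) (rotField x z)
      + 2 * ∑ x, A.quad z (rotField x (rotField x z))| ≤ 4 * (M * confNormSq z) := by
    rw [abs_le] at hdiag hsnd ⊢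
    constructor <;> linarith [hdiag.1, hdiag.2, hsnd.1, hsnd.2]
  refine (abs_add_le _ _).trans ?_
  rw [abs_mul γ, abs_of_pos hγ]
  have h := mul_le_mul_of_nonneg_left hrot hγ.le
  linarith

theorem controlledBound_generate {ω0 γ : ℝ} (hω0 : 0 < ω0) (hγ : 0 < γ)
    {A : ∀ N : ℕ, QuadObs N} {K : ℝ} (hK : 0 ≤ K) (hA : controlledBound ω0 A K) :
    controlledBound ω0 (fun N => (A N).generate ω0 γ)
      (2 * (1 + 2 * (1 + (ω0 ^ 2)⁻¹)) * ((1 + 3 * (2 + (2 + ω0 ^ 2) ^ 2) + 4 * γ)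
        * (2 + ω0 ^ 2)) * K) := by
  intro N z hz
  have : NeZero N := ⟨by rintro rfl; simp [totalEnergy] at hz⟩
  have heval : ∀ v, 0 < totalEnergy ω0 v → |(A N).eval v| ≤ K * totalEnergy ω0 v :=
    fun v hv => (hA N v hv).1
  have hpos : ∀ v : Conf N, v ≠ 0 → 0 < totalEnergy ω0 v := fun v hv => by
    have h := (confNormSq_nonneg v).lt_of_ne fun h => hv (confNormSq_eq_zero h.symm)
    exact pos_of_mul_pos_right (h.trans_le (confNormSq_le_totalEnergy hω0 v)) (by positivity)
  have hconst : (A N).const = 0 := ((A N).homogeneous_of_abs_eval_le heval hz).1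
  have hlin : ∀ v, (A N).lin v = 0 := fun v => by
    rcases eq_or_ne v 0 with rfl | hv
    · exact map_zero _
    · exact ((A N).homogeneous_of_abs_eval_le heval (hpos v hv)).2
  have hquad : ∀ v, |(A N).quad v v| ≤ (2 + ω0 ^ 2) * K * confNormSq v := fun v => by
    rcases eq_or_ne v 0 with rfl | hv
    · rw [map_zero, abs_zero]
      exact mul_nonneg (by positivity) (confNormSq_nonneg _)
    · have h := heval v (hpos v hv)
      rw [QuadObs.eval, hconst, hlin, zero_add, zero_add] at h
      exact h.trans ((mul_le_mul_of_nonneg_left (totalEnergy_le_confNormSq ω0 v) hK).trans_eq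
        (by ring))
  have h := ((A N).generate ω0 γ).controlled_of_abs_quad_le hω0
    (M := (1 + 3 * (2 + (2 + ω0 ^ 2) ^ 2) + 4 * γ) * ((2 + ω0 ^ 2) * K)) (by positivity) rfl
    (fun v => by simp [QuadObs.generate, hlin])
    ((A N).abs_generate_quad_self_le hγ (by positivity) hquad) hz
  simpa only [mul_assoc] using h

/-- **The generator preserves `𝔈`** (Lemma 4.1): there is a constant `C`
(depending only on `ω₀` and `γ`) such that for every `A ∈ 𝔈`, the sequence
`𝒢A` is again a sequence of degree-two polynomials controlled by the energy and
`‖𝒢A‖_𝔈 ≤ C ‖A‖_𝔈`. -/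
theorem generator_controlled_by_energy
    (ω0 γ : ℝ) (hω0 : 0 < ω0) (hγ : 0 < γ) :
    ∃ C : ℝ, 0 < C ∧
      ∀ A : ∀ N : ℕ, QuadObs N, (∃ K : ℝ, 0 ≤ K ∧ controlledBound ω0 A K) →
        ∃ GA : ∀ N : ℕ, QuadObs N,
          (∀ (N : ℕ) (z : Conf N), (GA N).eval z = generator ω0 γ (A N) z) ∧
          (∃ K : ℝ, 0 ≤ K ∧ controlledBound ω0 GA K) ∧
          enNorm ω0 GA ≤ C * enNorm ω0 A := by
  have hC : 0 < 2 * (1 + 2 * (1 + (ω0 ^ 2)⁻¹)) * ((1 + 3 * (2 + (2 + ω0 ^ 2) ^ 2) + 4 * γ)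
      * (2 + ω0 ^ 2)) := by positivity
  refine ⟨_, hC, fun A hA => ⟨fun N => (A N).generate ω0 γ,
    fun N z => (A N).eval_generate ω0 γ z, ?_, ?_⟩⟩
  · obtain ⟨K, hK, hAK⟩ := hA
    exact ⟨_, mul_nonneg hC.le hK, controlledBound_generate hω0 hγ hK hAK⟩
  · rw [← div_le_iff₀' hC]
    refine le_csInf hA fun K hK => (div_le_iff₀' hC).2 ?_
    exact csInf_le ⟨0, fun _ h => h.1⟩
      ⟨mul_nonneg hC.le hK.1, controlledBound_generate hω0 hγ hK.1 hK.2⟩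

end
end

section
/- Effective derivative lemma: Fix ω₀ > 0 and γ > 0, and for N ∈ ℕ and j ∈ ℤ set μ_j = ω₀² + 4 sin²(πj/N) and Φ̃(μ,μ') = 4γ²(μ−μ') / ( 2γ²(μ+μ') + (μ−μ')² ). Then there exists a constant C (depending only on ω₀ and γ) such that for every N ∈ ℕ and every integer k with −N/2 < k ≤ N/2: | ∑_{j=0}^{N−1} (e^{2πij/N} − 1) Φ̃(μ_j, μ_{k−j}) − 2πik·D | ≤ C k² / N, where D = 2/(2+ω₀²+ω₀√(ω₀²+4)). -/
/-!
Statement 10: Effective derivative lemma (Lemma 5.4 of the paper):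
for `μ_j = ω₀² + 4 sin²(πj/N)` and
`Φ̃(μ,μ') = 4γ²(μ-μ') / (2γ²(μ+μ') + (μ-μ')²)`,
`∑_{j∈ℤ_N} (e^{2πij/N} - 1) Φ̃(μ_j, μ_{k-j}) = 2πik D + O(k²/N)`.
-/

open Real Complex

noncomputable section

/-- The dispersion eigenvalues `μ_j = ω₀² + 4 sin²(πj/N)` (indices mod `N`). -/
def muDisp (ω0 : ℝ) (N : ℕ) (j : ℤ) : ℝ :=
  ω0 ^ 2 + 4 * Real.sin (Real.pi * j / N) ^ 2

/-- `Φ̃(μ,μ') = 4γ²(μ-μ') / (2γ²(μ+μ') + (μ-μ')²)`. -/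
def PhiTilde (γ m m' : ℝ) : ℝ :=
  4 * γ ^ 2 * (m - m') / (2 * γ ^ 2 * (m + m') + (m - m') ^ 2)

/-- The thermal diffusion coefficient `D = 2/(2 + ω₀² + ω₀√(ω₀²+4))`. -/
def Dcoef (ω0 : ℝ) : ℝ := 2 / (2 + ω0 ^ 2 + ω0 * Real.sqrt (ω0 ^ 2 + 4))

/-- First order Taylor estimate for a primitive of a Lipschitz function. -/
theorem abs_primitive_sub_le {F f : ℝ → ℝ} {L : ℝ} (hF : ∀ x, HasDerivAt F (f x) x)
    (hf : ∀ x y, |f x - f y| ≤ L * |x - y|) (hL : 0 ≤ L) (x h : ℝ) :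
    |F (x + h) - F x - h * f x| ≤ L * h ^ 2 := by
  have key := (convex_uIcc x (x + h)).norm_image_sub_le_of_norm_hasDerivWithin_le
    (f := fun y => F y - y * f x) (f' := fun y => f y - f x) (C := L * |h|)
    (x := x) (y := x + h)
    (fun y _ => by
      have := (hF y).sub ((hasDerivAt_id y).mul_const (f x))
      exact (this.congr_deriv (by ring)).hasDerivWithinAt)
    (fun y hy => by
      refine (hf y x).trans (mul_le_mul_of_nonneg_left ?_ hL)
      simpa using Set.abs_sub_left_of_mem_uIcc hy)
    Set.left_mem_uIcc Set.right_mem_uIcc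
  simp only [Real.norm_eq_abs] at key
  have e : F (x + h) - (x + h) * f x - (F x - x * f x) = F (x + h) - F x - h * f x := by ring
  rw [e, add_sub_cancel_left, mul_assoc, abs_mul_abs_self] at key
  linarith

/-- Error bound for left Riemann sums of a Lipschitz function. -/
theorem abs_riemann_sum_sub_le {F f : ℝ → ℝ} {L : ℝ} (hF : ∀ x, HasDerivAt F (f x) x)
    (hf : ∀ x y, |f x - f y| ≤ L * |x - y|) (hL : 0 ≤ L) (h : ℝ) (N : ℕ) :
    |h * ∑ j ∈ Finset.range N, f (j * h) - (F (N * h) - F 0)| ≤ N * (L * h ^ 2) := by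
  have tele : F (N * h) - F 0 = ∑ j ∈ Finset.range N, (F ((j : ℝ) * h + h) - F (j * h)) := by
    have := Finset.sum_range_sub (fun j : ℕ => F (j * h)) N
    simp only [Nat.cast_add, Nat.cast_one, add_mul, one_mul, Nat.cast_zero, zero_mul] at this
    exact this.symm
  rw [tele, Finset.mul_sum, ← Finset.sum_sub_distrib]
  refine (Finset.abs_sum_le_sum_abs _ _).trans ?_
  refine (Finset.sum_le_card_nsmul _ _ (L * h ^ 2) fun j _ => ?_).trans (by simp)
  rw [abs_sub_comm]
  exact abs_primitive_sub_le hF hf hL _ _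

/-- The continuous dispersion relation, `muDisp ω0 N j = dispersion ω0 (2πj/N)`. -/
def dispersion (ω0 θ : ℝ) : ℝ := ω0 ^ 2 + 2 - 2 * Real.cos θ

theorem sq_le_dispersion (ω0 θ : ℝ) : ω0 ^ 2 ≤ dispersion ω0 θ := by
  have := Real.cos_le_one θ
  unfold dispersion
  linarith

theorem muDisp_eq_dispersion (ω0 : ℝ) (N : ℕ) (j : ℤ) :
    muDisp ω0 N j = dispersion ω0 (j * (2 * π / N)) := by
  have h := Real.cos_two_mul (π * j / N)
  have e : (j : ℝ) * (2 * π / N) = 2 * (π * j / N) := by ring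
  rw [muDisp, dispersion, e, h, Real.sin_sq]
  ring

theorem abs_dispersion_sub_le (ω0 x y : ℝ) :
    |dispersion ω0 x - dispersion ω0 y| ≤ 2 * |x - y| := by
  have h : dispersion ω0 x - dispersion ω0 y = 2 * (Real.cos y - Real.cos x) := by
    unfold dispersion; ring
  rw [h, abs_mul, abs_two, abs_sub_comm x y]
  exact mul_le_mul_of_nonneg_left (Real.abs_cos_sub_cos_le _ _) zero_le_two

theorem abs_dispersion_sub_le_four (ω0 x y : ℝ) :
    |dispersion ω0 x - dispersion ω0 y| ≤ 4 := by
  unfold dispersion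
  rw [abs_le]
  constructor <;>
    linarith [Real.cos_le_one x, Real.cos_le_one y, Real.neg_one_le_cos x, Real.neg_one_le_cos y]

/-- Linearization of `PhiTilde` on the diagonal. -/
theorem abs_PhiTilde_sub_div_le {γ c m m' : ℝ} (hγ : 0 < γ) (hc : 0 < c) (hm : c ≤ m)
    (hm' : c ≤ m') (hd : |m - m'| ≤ 4) :
    |PhiTilde γ m m' - (m - m') / m| ≤
      (2 * γ ^ 2 + 4) / (4 * γ ^ 2 * c ^ 2) * (m - m') ^ 2 := by
  have hγ2 : 0 < γ ^ 2 := by positivity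
  have hm0 : 0 < m := hc.trans_le hm
  have hden : 4 * γ ^ 2 * c ≤ 2 * γ ^ 2 * (m + m') + (m - m') ^ 2 := by
    nlinarith [sq_nonneg (m - m')]
  have hden0 : 0 < 2 * γ ^ 2 * (m + m') + (m - m') ^ 2 := lt_of_lt_of_le (by positivity) hden
  have e : PhiTilde γ m m' - (m - m') / m =
      (m - m') ^ 2 * (2 * γ ^ 2 - (m - m')) /
        (m * (2 * γ ^ 2 * (m + m') + (m - m') ^ 2)) := by
    rw [PhiTilde, div_sub_div _ _ hden0.ne' hm0.ne', div_eq_div_iff (by positivity) (by positivity)]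
    ring
  rw [e, abs_div, abs_mul, abs_of_nonneg (sq_nonneg (m - m')), abs_of_pos (mul_pos hm0 hden0),
    div_mul_eq_mul_div, mul_comm ((m - m') ^ 2)]
  have h1 : |2 * γ ^ 2 - (m - m')| ≤ 2 * γ ^ 2 + 4 := by
    rw [abs_le] at hd ⊢
    constructor <;> linarith
  have h2 : 4 * γ ^ 2 * c ^ 2 ≤ m * (2 * γ ^ 2 * (m + m') + (m - m') ^ 2) := by
    calc 4 * γ ^ 2 * c ^ 2 = c * (4 * γ ^ 2 * c) := by ring
      _ ≤ _ := mul_le_mul hm hden (by positivity) hm0.le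
  gcongr

theorem abs_PhiTilde_dispersion_sub_le {ω0 γ : ℝ} (hω0 : 0 < ω0) (hγ : 0 < γ) (θ κ : ℝ) :
    |PhiTilde γ (dispersion ω0 θ) (dispersion ω0 (θ - κ)) -
        2 * κ * Real.sin θ / dispersion ω0 θ| ≤
      ((2 * γ ^ 2 + 4) / (γ ^ 2 * ω0 ^ 4) + 2 / ω0 ^ 2) * κ ^ 2 := by
  have hω2 : 0 < ω0 ^ 2 := by positivity
  have hm := sq_le_dispersion ω0 θ
  have hm0 := hω2.trans_le hm
  have h1 := abs_PhiTilde_sub_div_le hγ hω2 hm (sq_le_dispersion ω0 (θ - κ))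
    (abs_dispersion_sub_le_four ω0 _ _)
  have hd : (dispersion ω0 θ - dispersion ω0 (θ - κ)) ^ 2 ≤ 4 * κ ^ 2 := by
    have := abs_dispersion_sub_le ω0 θ (θ - κ)
    rw [sub_sub_cancel] at this
    calc _ = |dispersion ω0 θ - dispersion ω0 (θ - κ)| ^ 2 := (sq_abs _).symm
      _ ≤ (2 * |κ|) ^ 2 := by gcongr
      _ = 4 * κ ^ 2 := by rw [mul_pow, sq_abs]; norm_num
  have h2 := abs_primitive_sub_le (F := fun x => -Real.cos x) (f := Real.sin) (L := 1)
    (fun x => (Real.hasDerivAt_cos x).neg.congr_deriv (neg_neg _))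
    (fun x y => by simpa using Real.abs_sin_sub_sin_le x y) zero_le_one θ (-κ)
  have h3 : |(dispersion ω0 θ - dispersion ω0 (θ - κ)) / dispersion ω0 θ -
      2 * κ * Real.sin θ / dispersion ω0 θ| ≤ 2 / ω0 ^ 2 * κ ^ 2 := by
    rw [← sub_div, abs_div, abs_of_pos hm0, div_mul_eq_mul_div]
    have e : dispersion ω0 θ - dispersion ω0 (θ - κ) - 2 * κ * Real.sin θ =
        -2 * (-Real.cos (θ + -κ) - -Real.cos θ - -κ * Real.sin θ) := by
      unfold dispersion
      rw [← sub_eq_add_neg]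
      ring
    have h4 : |dispersion ω0 θ - dispersion ω0 (θ - κ) - 2 * κ * Real.sin θ| ≤ 2 * κ ^ 2 := by
      rw [e, abs_mul, abs_neg, abs_two]
      linarith [neg_sq κ]
    gcongr
  have h5 : (2 * γ ^ 2 + 4) / (4 * γ ^ 2 * (ω0 ^ 2) ^ 2) *
      (dispersion ω0 θ - dispersion ω0 (θ - κ)) ^ 2 ≤
      (2 * γ ^ 2 + 4) / (γ ^ 2 * ω0 ^ 4) * κ ^ 2 := by
    calc _ ≤ (2 * γ ^ 2 + 4) / (4 * γ ^ 2 * (ω0 ^ 2) ^ 2) * (4 * κ ^ 2) := by gcongr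
      _ = _ := by field_simp
  have h6 := abs_sub_le (PhiTilde γ (dispersion ω0 θ) (dispersion ω0 (θ - κ)))
    ((dispersion ω0 θ - dispersion ω0 (θ - κ)) / dispersion ω0 θ)
    (2 * κ * Real.sin θ / dispersion ω0 θ)
  linarith

theorem abs_mul_sin_div_dispersion_sub_le {ω0 : ℝ} (hω0 : 0 < ω0) {w : ℝ → ℝ}
    (hw : ∀ x, |w x| ≤ 2) (hwl : ∀ x y, |w x - w y| ≤ |x - y|) (x y : ℝ) :
    |w x * Real.sin x / dispersion ω0 x - w y * Real.sin y / dispersion ω0 y| ≤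
      (3 / ω0 ^ 2 + 4 / ω0 ^ 4) * |x - y| := by
  have hω2 : 0 < ω0 ^ 2 := by positivity
  have hx := sq_le_dispersion ω0 x
  have hy := sq_le_dispersion ω0 y
  have hx0 := hω2.trans_le hx
  have hy0 := hω2.trans_le hy
  have e : w x * Real.sin x / dispersion ω0 x - w y * Real.sin y / dispersion ω0 y =
      ((w x - w y) * Real.sin x + w y * (Real.sin x - Real.sin y)) / dispersion ω0 x +
      w y * Real.sin y * (dispersion ω0 y - dispersion ω0 x) /
        (dispersion ω0 x * dispersion ω0 y) := by
    field_simp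
    ring
  have h1 : |(w x - w y) * Real.sin x + w y * (Real.sin x - Real.sin y)| ≤ 3 * |x - y| := by
    refine (abs_add_le _ _).trans ?_
    rw [abs_mul, abs_mul]
    have a1 := mul_le_mul (hwl x y) (Real.abs_sin_le_one x) (abs_nonneg _) (abs_nonneg _)
    have a2 := mul_le_mul (hw y) (Real.abs_sin_sub_sin_le x y) (abs_nonneg _) zero_le_two
    linarith
  have h2 : |w y * Real.sin y * (dispersion ω0 y - dispersion ω0 x)| ≤ 4 * |x - y| := by
    rw [abs_mul, abs_mul]
    have a1 := mul_le_mul (hw y) (Real.abs_sin_le_one y) (abs_nonneg _) zero_le_two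
    have a2 := mul_le_mul a1 (abs_dispersion_sub_le ω0 y x) (abs_nonneg _) (by norm_num)
    rw [abs_sub_comm y x] at a2
    linarith
  rw [e]
  refine (abs_add_le _ _).trans ?_
  rw [abs_div, abs_div, abs_of_pos hx0, abs_of_pos (mul_pos hx0 hy0), add_mul,
    div_mul_eq_mul_div, div_mul_eq_mul_div]
  have h3 : ω0 ^ 4 ≤ dispersion ω0 x * dispersion ω0 y := by
    calc ω0 ^ 4 = ω0 ^ 2 * ω0 ^ 2 := by ring
      _ ≤ _ := mul_le_mul hx hy hω2.le hx0.le
  gcongr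

/-- The sum of `PhiTilde` against a bounded Lipschitz weight `w`, in terms of a primitive of
`w * sin / dispersion`. -/
theorem exists_abs_sum_mul_PhiTilde_sub_le {ω0 γ : ℝ} (hω0 : 0 < ω0) (hγ : 0 < γ)
    {w F : ℝ → ℝ} (hw : ∀ x, |w x| ≤ 2) (hwl : ∀ x y, |w x - w y| ≤ |x - y|)
    (hF : ∀ x, HasDerivAt F (w x * Real.sin x / dispersion ω0 x) x) :
    ∃ C : ℝ, 0 < C ∧ ∀ N : ℕ, 1 ≤ N → ∀ k : ℤ,
      |∑ j ∈ Finset.range N, w (j * (2 * π / N)) *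
            PhiTilde γ (muDisp ω0 N j) (muDisp ω0 N (k - j)) - 2 * k * (F (2 * π) - F 0)| ≤
        C * (k : ℝ) ^ 2 / N := by
  set A : ℝ := (2 * γ ^ 2 + 4) / (γ ^ 2 * ω0 ^ 4) + 2 / ω0 ^ 2 with hA
  set L : ℝ := 3 / ω0 ^ 2 + 4 / ω0 ^ 4 with hL
  have hA0 : 0 < A := by positivity
  have hL0 : 0 < L := by positivity
  refine ⟨8 * π ^ 2 * A + 8 * π ^ 2 * L, by positivity, fun N hN k => ?_⟩
  have hN0 : (0 : ℝ) < N := by exact_mod_cast hN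
  set h : ℝ := 2 * π / N with hh
  have hNh : N * h = 2 * π := by rw [hh]; field_simp
  have hR := abs_riemann_sum_sub_le hF (abs_mul_sin_div_dispersion_sub_le hω0 hw hwl) hL0.le h N
  rw [hNh] at hR
  have hk : |(k : ℝ)| ≤ (k : ℝ) ^ 2 := by
    rw [← sq_abs]
    rcases eq_or_ne k 0 with rfl | hk0
    · simp
    · exact le_self_pow₀ (by exact_mod_cast Int.one_le_abs hk0) two_ne_zero
  have hterm : ∀ j : ℕ, |w (j * h) * PhiTilde γ (muDisp ω0 N j) (muDisp ω0 N (k - j)) -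
      2 * k * (h * (w (j * h) * Real.sin (j * h) / dispersion ω0 (j * h)))| ≤
      2 * (A * (k * h) ^ 2) := by
    intro j
    have e : muDisp ω0 N (k - j) = dispersion ω0 (j * h - k * h) := by
      rw [muDisp_eq_dispersion, dispersion, dispersion, ← Real.cos_neg, ← hh]
      push_cast
      ring_nf
    rw [e, muDisp_eq_dispersion, ← hh, Int.cast_natCast]
    have e2 : ∀ P : ℝ, w (j * h) * P -
        2 * k * (h * (w (j * h) * Real.sin (j * h) / dispersion ω0 (j * h))) =
        w (j * h) * (P - 2 * (k * h) * Real.sin (j * h) / dispersion ω0 (j * h)) := by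
      intro P; ring
    rw [e2, abs_mul]
    exact mul_le_mul (hw _) (abs_PhiTilde_dispersion_sub_le hω0 hγ _ _) (abs_nonneg _) zero_le_two
  have hsum : |∑ j ∈ Finset.range N, w (j * h) *
        PhiTilde γ (muDisp ω0 N j) (muDisp ω0 N (k - j)) -
      2 * k * (h * ∑ j ∈ Finset.range N,
        (w (j * h) * Real.sin (j * h) / dispersion ω0 (j * h)))| ≤
      N * (2 * (A * (k * h) ^ 2)) := by
    rw [Finset.mul_sum, Finset.mul_sum, ← Finset.sum_sub_distrib]
    refine (Finset.abs_sum_le_sum_abs _ _).trans ?_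
    exact (Finset.sum_le_card_nsmul _ _ _ fun j _ => hterm j).trans (by simp)
  have hR2 : |2 * k * (h * ∑ j ∈ Finset.range N,
        (w (j * h) * Real.sin (j * h) / dispersion ω0 (j * h))) -
      2 * k * (F (2 * π) - F 0)| ≤ 2 * (k : ℝ) ^ 2 * (N * (L * h ^ 2)) := by
    rw [← mul_sub, abs_mul, abs_mul, abs_two]
    gcongr
  refine (abs_sub_le _ _ _).trans ((add_le_add hsum hR2).trans (le_of_eq ?_))
  rw [hh]
  field_simp
  ring

theorem Dcoef_pos {ω0 : ℝ} (hω0 : 0 < ω0) : 0 < Dcoef ω0 := by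
  unfold Dcoef
  positivity

theorem Dcoef_lt_one {ω0 : ℝ} (hω0 : 0 < ω0) : Dcoef ω0 < 1 := by
  have h : 0 < ω0 ^ 2 + ω0 * √(ω0 ^ 2 + 4) := by positivity
  unfold Dcoef
  rw [div_lt_one (by positivity)]
  linarith

/-- `Dcoef ω0` is a root of `r² - (ω0² + 2) r + 1`. -/
theorem Dcoef_sq_add_one {ω0 : ℝ} (hω0 : 0 < ω0) :
    Dcoef ω0 ^ 2 + 1 = (ω0 ^ 2 + 2) * Dcoef ω0 := by
  have hs : √(ω0 ^ 2 + 4) ^ 2 = ω0 ^ 2 + 4 := Real.sq_sqrt (by positivity)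
  have h0 : 2 + ω0 ^ 2 + ω0 * √(ω0 ^ 2 + 4) ≠ 0 := by positivity
  unfold Dcoef
  field_simp
  linear_combination ω0 ^ 2 * hs

/-- A primitive of `sin² / dispersion`, smooth on the whole line. -/
theorem hasDerivAt_primitive_sin_sq_div_dispersion {ω0 : ℝ} (hω0 : 0 < ω0) (θ : ℝ) :
    HasDerivAt (fun x => Real.sin x / 2 + Dcoef ω0 * x / 2 - ((Dcoef ω0)⁻¹ - Dcoef ω0) / 2 *
        Real.arctan (Dcoef ω0 * Real.sin x / (1 - Dcoef ω0 * Real.cos x)))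
      (Real.sin θ * Real.sin θ / dispersion ω0 θ) θ := by
  have hr0 := Dcoef_pos hω0
  have hr1 := Dcoef_lt_one hω0
  have hr := Dcoef_sq_add_one hω0
  have hμ : 0 < dispersion ω0 θ := lt_of_lt_of_le (by positivity) (sq_le_dispersion ω0 θ)
  set r := Dcoef ω0
  have hden : 0 < 1 - r * Real.cos θ := by nlinarith [Real.cos_le_one θ]
  have hμr : r * dispersion ω0 θ = 1 + r ^ 2 - 2 * r * Real.cos θ := by
    unfold dispersion
    linear_combination -hr
  have hq := ((Real.hasDerivAt_sin θ).const_mul r).div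
    (((Real.hasDerivAt_cos θ).const_mul r).const_sub 1) hden.ne'
  have := (((Real.hasDerivAt_sin θ).div_const 2).add
    (((hasDerivAt_id θ).const_mul r).div_const 2)).sub
      (hq.arctan.const_mul ((r⁻¹ - r) / 2))
  refine this.congr_deriv ?_
  have hsc := Real.sin_sq_add_cos_sq θ
  have hpos : 0 < 1 + r ^ 2 - 2 * r * Real.cos θ := hμr ▸ mul_pos hr0 hμ
  have hμe : dispersion ω0 θ = (1 + r ^ 2 - 2 * r * Real.cos θ) / r := by
    rw [← hμr]; field_simp
  have hder : 1 / (1 + (r * Real.sin θ / (1 - r * Real.cos θ)) ^ 2) *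
      ((r * Real.cos θ * (1 - r * Real.cos θ) - r * Real.sin θ * -(r * -Real.sin θ)) /
        (1 - r * Real.cos θ) ^ 2) =
      (r * Real.cos θ - r ^ 2) / (1 + r ^ 2 - 2 * r * Real.cos θ) := by
    have e1 : 1 + (r * Real.sin θ / (1 - r * Real.cos θ)) ^ 2 =
        (1 + r ^ 2 - 2 * r * Real.cos θ) / (1 - r * Real.cos θ) ^ 2 := by
      field_simp
      linear_combination r ^ 2 * hsc
    have e2 : r * Real.cos θ * (1 - r * Real.cos θ) - r * Real.sin θ * -(r * -Real.sin θ) =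
        r * Real.cos θ - r ^ 2 := by
      linear_combination -r ^ 2 * hsc
    rw [e1, e2]
    field_simp
  simp only [Pi.div_apply]
  have hs2 : Real.sin θ * Real.sin θ = 1 - Real.cos θ ^ 2 := by linear_combination hsc
  rw [hder, hμe, hs2]
  generalize hq' : 1 + r ^ 2 - 2 * r * Real.cos θ = q at hpos
  field_simp
  rw [← hq']
  ring

theorem hasDerivAt_primitive_cos_sub_one_mul_sin_div_dispersion {ω0 : ℝ} (hω0 : 0 < ω0) (θ : ℝ) :
    HasDerivAt (fun x => Real.cos x / 2 + ω0 ^ 2 / 4 * Real.log (dispersion ω0 x))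
      ((Real.cos θ - 1) * Real.sin θ / dispersion ω0 θ) θ := by
  have hμ : 0 < dispersion ω0 θ := lt_of_lt_of_le (by positivity) (sq_le_dispersion ω0 θ)
  have hd : HasDerivAt (dispersion ω0) (2 * Real.sin θ) θ := by
    have := ((Real.hasDerivAt_cos θ).const_mul 2).const_sub (ω0 ^ 2 + 2)
    exact this.congr_deriv (by ring)
  refine (((Real.hasDerivAt_cos θ).div_const 2).add
    ((hd.log hμ.ne').const_mul (ω0 ^ 2 / 4))).congr_deriv ?_
  field_simp
  unfold dispersion
  ring

/-- **Effective derivative lemma**: there is a constant `C` (depending only on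
`ω₀` and `γ`) such that for every `N ∈ ℕ` and every integer `k` with
`-N/2 < k ≤ N/2`,
`|∑_{j=0}^{N-1} (e^{2πij/N} - 1) Φ̃(μ_j, μ_{k-j}) - 2πik D| ≤ C k²/N`. -/
theorem effective_derivative
    (ω0 γ : ℝ) (hω0 : 0 < ω0) (hγ : 0 < γ) :
    ∃ C : ℝ, 0 < C ∧
      ∀ (N : ℕ), 1 ≤ N → ∀ k : ℤ, -((N : ℝ) / 2) < (k : ℝ) → (k : ℝ) ≤ (N : ℝ) / 2 →
        ‖(∑ j ∈ Finset.range N,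
              (Complex.exp (2 * Real.pi * Complex.I * j / N) - 1)
                * ((PhiTilde γ (muDisp ω0 N j) (muDisp ω0 N (k - j)) : ℝ) : ℂ))
            - 2 * Real.pi * Complex.I * (k : ℂ) * ((Dcoef ω0 : ℝ) : ℂ)‖
          ≤ C * (k : ℝ) ^ 2 / N := by
  obtain ⟨C₁, hC₁, h₁⟩ := exists_abs_sum_mul_PhiTilde_sub_le hω0 hγ (w := fun x => Real.cos x - 1)
    (fun x => by
      rw [abs_le]
      constructor <;> linarith [Real.cos_le_one x, Real.neg_one_le_cos x])
    (fun x y => by simpa using Real.abs_cos_sub_cos_le x y)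
    (hasDerivAt_primitive_cos_sub_one_mul_sin_div_dispersion hω0)
  obtain ⟨C₂, hC₂, h₂⟩ := exists_abs_sum_mul_PhiTilde_sub_le hω0 hγ (w := Real.sin)
    (fun x => (Real.abs_sin_le_one x).trans one_le_two) Real.abs_sin_sub_sin_le
    (hasDerivAt_primitive_sin_sq_div_dispersion hω0)
  refine ⟨C₁ + C₂, by positivity, fun N hN k _ _ => ?_⟩
  have hre := h₁ N hN k
  have him := h₂ N hN k
  have hexp : ∀ j : ℕ, Complex.exp (2 * Real.pi * Complex.I * j / N) - 1 =
      ((Real.cos (j * (2 * π / N)) - 1 : ℝ) : ℂ) +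
        ((Real.sin (j * (2 * π / N)) : ℝ) : ℂ) * Complex.I := by
    intro j
    have e : 2 * Real.pi * Complex.I * j / N = ((j * (2 * π / N) : ℝ) : ℂ) * Complex.I := by
      push_cast
      ring
    rw [e, Complex.exp_mul_I, ← Complex.ofReal_cos, ← Complex.ofReal_sin]
    push_cast
    ring
  have hexp_re : ∀ j : ℕ, (Complex.exp (2 * Real.pi * Complex.I * j / N) - 1).re =
      Real.cos (j * (2 * π / N)) - 1 := by
    intro j
    rw [hexp, Complex.add_re, Complex.re_ofReal_mul, Complex.ofReal_re, Complex.I_re]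
    ring
  have hexp_im : ∀ j : ℕ, (Complex.exp (2 * Real.pi * Complex.I * j / N) - 1).im =
      Real.sin (j * (2 * π / N)) := by
    intro j
    rw [hexp, Complex.add_im, Complex.im_ofReal_mul, Complex.ofReal_im, Complex.I_im]
    ring
  refine (Complex.norm_le_abs_re_add_abs_im _).trans ?_
  rw [add_mul, add_div]
  refine add_le_add ?_ ?_
  · refine le_of_eq_of_le (congrArg _ ?_) hre
    rw [Complex.sub_re, Complex.re_sum]
    simp only [Complex.re_mul_ofReal, hexp_re]
    simp [dispersion]
  · refine le_of_eq_of_le (congrArg _ ?_) him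
    rw [Complex.sub_im, Complex.im_sum]
    simp only [Complex.im_mul_ofReal, hexp_im]
    simp
    ring

end
end

section
/- Diffusion coefficient integral identity: For every ω₀ > 0, ∫₀^{2π} sin²(ϑ) / (ω₀² + 2 − 2cos(ϑ)) dϑ = π · 2/(2 + ω₀² + ω₀√(ω₀²+4)). Equivalently, the integral equals π·a₋ where a± = 1 + ω₀²/2 ± √(ω₀² + ω₀⁴/4) are the two roots of z² + 1 − (ω₀²+2)z = 0 and a₋a₊ = 1. -/
/-!
Statement 11: Diffusion coefficient integral identity:
`∫₀^{2π} sin²ϑ/(ω₀² + 2 − 2cosϑ) dϑ = π · 2/(2 + ω₀² + ω₀√(ω₀²+4)) = π a₋`,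
where `a± = 1 + ω₀²/2 ± √(ω₀² + ω₀⁴/4)` are the roots of `z² + 1 − (ω₀²+2)z = 0`
and `a₋ a₊ = 1`.
-/

open Real

noncomputable section

lemma one_sub_mul_cos_pos {r : ℝ} (h0 : 0 < r) (h1 : r < 1) (θ : ℝ) :
    0 < 1 - r * Real.cos θ := by
  nlinarith [Real.cos_le_one θ]

lemma one_add_sq_sub_cos_pos {r : ℝ} (h0 : 0 < r) (h1 : r < 1) (θ : ℝ) :
    0 < 1 + r ^ 2 - 2 * r * Real.cos θ := by
  nlinarith [Real.cos_le_one θ, sq_nonneg (1 - r), sub_pos.2 h1]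

lemma hasDerivAt_arctan_poisson {r : ℝ} (h0 : 0 < r) (h1 : r < 1) (θ : ℝ) :
    HasDerivAt (fun x : ℝ => Real.arctan (r * Real.sin x / (1 - r * Real.cos x)))
      ((r * Real.cos θ - r ^ 2) / (1 + r ^ 2 - 2 * r * Real.cos θ)) θ := by
  have hp := (one_sub_mul_cos_pos h0 h1 θ).ne'
  have hD := (one_add_sq_sub_cos_pos h0 h1 θ).ne'
  have hsc := Real.sin_sq_add_cos_sq θ
  have hq : 1 + (r * Real.sin θ / (1 - r * Real.cos θ)) ^ 2
      = (1 + r ^ 2 - 2 * r * Real.cos θ) / (1 - r * Real.cos θ) ^ 2 := by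
    field_simp
    linear_combination r ^ 2 * hsc
  have h := (((Real.hasDerivAt_sin θ).const_mul r).div
    (((Real.hasDerivAt_cos θ).const_mul r).const_sub 1) hp).arctan
  refine h.congr_deriv ?_
  change 1 / (1 + (r * Real.sin θ / (1 - r * Real.cos θ)) ^ 2) * _ = _
  rw [hq]
  generalize 1 + r ^ 2 - 2 * r * Real.cos θ = D at hD ⊢
  field_simp
  linear_combination -r * hsc

lemma integral_sin_sq_div_sub_cos {r : ℝ} (h0 : 0 < r) (h1 : r < 1) :
    ∫ θ in (0 : ℝ)..(2 * Real.pi), Real.sin θ ^ 2 / (r + r⁻¹ - 2 * Real.cos θ)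
      = Real.pi * r := by
  have hr := h0.ne'
  have hden (θ : ℝ) : r + r⁻¹ - 2 * Real.cos θ = (1 + r ^ 2 - 2 * r * Real.cos θ) / r := by
    field_simp
    ring
  have hne (θ : ℝ) : r + r⁻¹ - 2 * Real.cos θ ≠ 0 := by
    rw [hden]
    exact (div_pos (one_add_sq_sub_cos_pos h0 h1 θ) h0).ne'
  have hderiv (θ : ℝ) : HasDerivAt (fun x : ℝ => r / 2 * x
      - (1 - r ^ 2) / (2 * r) * Real.arctan (r * Real.sin x / (1 - r * Real.cos x))
      + Real.sin x / 2) (Real.sin θ ^ 2 / (r + r⁻¹ - 2 * Real.cos θ)) θ := by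
    have hD := (one_add_sq_sub_cos_pos h0 h1 θ).ne'
    refine ((((hasDerivAt_id θ).const_mul (r / 2)).sub
      ((hasDerivAt_arctan_poisson h0 h1 θ).const_mul ((1 - r ^ 2) / (2 * r)))).add
      ((Real.hasDerivAt_sin θ).div_const 2)).congr_deriv ?_
    rw [hden, Real.sin_sq]
    generalize hDd : 1 + r ^ 2 - 2 * r * Real.cos θ = D at hD ⊢
    field_simp
    linear_combination -(r + Real.cos θ) * hDd
  have hcont : Continuous fun θ : ℝ => Real.sin θ ^ 2 / (r + r⁻¹ - 2 * Real.cos θ) :=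
    Continuous.div (by fun_prop) (by fun_prop) hne
  rw [intervalIntegral.integral_eq_sub_of_hasDerivAt (fun θ _ => hderiv θ)
    (hcont.intervalIntegrable _ _)]
  simp
  ring

/-- **Diffusion coefficient integral identity**. -/
theorem diffusion_integral_identity (ω0 : ℝ) (hω0 : 0 < ω0) :
    (∫ θ in (0:ℝ)..(2 * Real.pi), Real.sin θ ^ 2 / (ω0 ^ 2 + 2 - 2 * Real.cos θ))
        = Real.pi * (2 / (2 + ω0 ^ 2 + ω0 * Real.sqrt (ω0 ^ 2 + 4))) ∧
    (∫ θ in (0:ℝ)..(2 * Real.pi), Real.sin θ ^ 2 / (ω0 ^ 2 + 2 - 2 * Real.cos θ))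
        = Real.pi * (1 + ω0 ^ 2 / 2 - Real.sqrt (ω0 ^ 2 + ω0 ^ 4 / 4)) ∧
    (1 + ω0 ^ 2 / 2 - Real.sqrt (ω0 ^ 2 + ω0 ^ 4 / 4)) ^ 2 + 1
        - (ω0 ^ 2 + 2) * (1 + ω0 ^ 2 / 2 - Real.sqrt (ω0 ^ 2 + ω0 ^ 4 / 4)) = 0 ∧
    (1 + ω0 ^ 2 / 2 + Real.sqrt (ω0 ^ 2 + ω0 ^ 4 / 4)) ^ 2 + 1
        - (ω0 ^ 2 + 2) * (1 + ω0 ^ 2 / 2 + Real.sqrt (ω0 ^ 2 + ω0 ^ 4 / 4)) = 0 ∧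
    (1 + ω0 ^ 2 / 2 - Real.sqrt (ω0 ^ 2 + ω0 ^ 4 / 4))
        * (1 + ω0 ^ 2 / 2 + Real.sqrt (ω0 ^ 2 + ω0 ^ 4 / 4)) = 1 := by
  have hnn : 0 ≤ ω0 ^ 2 + ω0 ^ 4 / 4 := by positivity
  have hs : Real.sqrt (ω0 ^ 2 + ω0 ^ 4 / 4) = ω0 * Real.sqrt (ω0 ^ 2 + 4) / 2 := by
    rw [Real.sqrt_eq_iff_mul_self_eq hnn (by positivity)]
    linear_combination -ω0 ^ 2 / 4 * Real.sq_sqrt (show 0 ≤ ω0 ^ 2 + 4 by positivity)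
  have hsq := Real.sq_sqrt hnn
  have hspos : 0 < Real.sqrt (ω0 ^ 2 + ω0 ^ 4 / 4) := Real.sqrt_pos.2 (by positivity)
  have hplus : 2 + ω0 ^ 2 + ω0 * Real.sqrt (ω0 ^ 2 + 4)
      = 2 * (1 + ω0 ^ 2 / 2 + Real.sqrt (ω0 ^ 2 + ω0 ^ 4 / 4)) := by
    rw [hs]
    ring
  rw [hplus]
  set S := Real.sqrt (ω0 ^ 2 + ω0 ^ 4 / 4)
  have hmul : (1 + ω0 ^ 2 / 2 - S) * (1 + ω0 ^ 2 / 2 + S) = 1 := by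
    linear_combination -hsq
  have hω2 : 0 < ω0 ^ 2 := by positivity
  have hpos : 0 < 1 + ω0 ^ 2 / 2 + S := by positivity
  have hinv : (1 + ω0 ^ 2 / 2 - S)⁻¹ = 1 + ω0 ^ 2 / 2 + S := inv_eq_of_mul_eq_one_right hmul
  have h0 : 0 < 1 + ω0 ^ 2 / 2 - S := by
    rw [← inv_pos, hinv]
    exact hpos
  have h1 : 1 + ω0 ^ 2 / 2 - S < 1 := by nlinarith
  have hint : ∫ θ in (0 : ℝ)..(2 * Real.pi),
      Real.sin θ ^ 2 / (ω0 ^ 2 + 2 - 2 * Real.cos θ) = Real.pi * (1 + ω0 ^ 2 / 2 - S) := by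
    rw [← integral_sin_sq_div_sub_cos h0 h1, hinv]
    congr! 4
    ring
  refine ⟨?_, hint, ?_, ?_, hmul⟩
  · rw [hint, eq_inv_of_mul_eq_one_left hmul]
    field_simp
  · linear_combination hsq
  · linear_combination hsq

end
end

section
/- Decay of discrete Fourier coefficients of sampled smooth functions: For each k ∈ ℕ there exists a constant C_k such that for every φ ∈ C^k(𝕋,ℂ), every N ∈ ℕ and every integer j with 1 ≤ |j| ≤ N/2, the discrete Fourier coefficient φ̂_j = N^{−1/2} ∑_{x=0}^{N−1} φ(x/N) e^{−2πijx/N} satisfies |φ̂_j| ≤ C_k ‖φ‖_{C^k} N^{1/2} / |j|^k. -/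
/-!
Statement 12: Decay of discrete Fourier coefficients of sampled smooth periodic
functions (Lemma F.1 of the paper): for `φ ∈ C^k(𝕋,ℂ)` and `1 ≤ |j| ≤ N/2`,
the discrete Fourier coefficient `φ̂_j = N^{-1/2} ∑_{x<N} φ(x/N) e^{-2πijx/N}`
satisfies `|φ̂_j| ≤ C_k ‖φ‖_{C^k} √N / |j|^k`.
-/

open Real Complex

noncomputable section

/-- The `C^k` norm of a (periodic) function, computed over one period `[0,1]`. -/
def cknormC (k : ℕ) (φ : ℝ → ℂ) : ℝ :=
  ∑ m ∈ Finset.range (k + 1),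
    sSup ((fun x => ‖iteratedDeriv m φ x‖) '' Set.Icc (0 : ℝ) 1)

theorem Function.Periodic.iteratedDeriv {φ : ℝ → ℂ} {c : ℝ} (hφ : Function.Periodic φ c) (m : ℕ) :
    Function.Periodic (iteratedDeriv m φ) c := by
  intro x
  have h := congrFun (iteratedDeriv_comp_add_const m φ c) x
  rw [← h, show (fun z => φ (z + c)) = φ from funext hφ]

/-- The `k`-th derivative of a periodic function is dominated by the `C^k` norm. -/
theorem norm_iteratedDeriv_le_cknormC {k : ℕ} {φ : ℝ → ℂ} (hφ : ContDiff ℝ k φ)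
    (hp : Function.Periodic φ 1) (x : ℝ) : ‖iteratedDeriv k φ x‖ ≤ cknormC k φ := by
  have hbdd : BddAbove ((fun x => ‖iteratedDeriv k φ x‖) '' Set.Icc (0 : ℝ) 1) :=
    isCompact_Icc.bddAbove_image
      ((hφ.continuous_iteratedDeriv k le_rfl).norm.continuousOn)
  have hper := hp.iteratedDeriv k
  obtain ⟨y, hy, hxy⟩ := hper.exists_mem_Ico₀ one_pos x
  rw [hxy]
  refine (le_csSup hbdd ⟨y, Set.Ico_subset_Icc_self hy, rfl⟩).trans ?_
  refine Finset.single_le_sum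
    (f := fun m => sSup ((fun x => ‖iteratedDeriv m φ x‖) '' Set.Icc (0 : ℝ) 1))
    (fun m _ => ?_) (Finset.self_mem_range_succ k)
  refine Real.sSup_nonneg ?_
  rintro _ ⟨z, -, rfl⟩
  exact norm_nonneg _

/-- Jordan's inequality on the unit circle. -/
theorem two_div_pi_mul_abs_le_norm_exp_sub_one {θ : ℝ} (hθ : |θ| ≤ π) :
    2 / π * |θ| ≤ ‖Complex.exp (Complex.I * θ) - 1‖ := by
  rw [Complex.norm_exp_I_mul_ofReal_sub_one, norm_mul, Real.norm_eq_abs, Real.norm_eq_abs,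
    Real.abs_sin_eq_sin_abs_of_abs_le_pi (by rw [abs_div, abs_two]; linarith [abs_nonneg θ]),
    abs_two, abs_div, abs_two]
  have h := Real.mul_le_sin (x := |θ| / 2) (by positivity) (by linarith)
  linarith

/-- Summation by parts for the discrete Fourier sum of a sampled periodic function. -/
theorem discrete_fourier_sum_forward_difference {φ : ℝ → ℂ} (hp : Function.Periodic φ 1)
    {N : ℕ} (hN : N ≠ 0) (j : ℤ) :
    Complex.exp (-(2 * π * Complex.I * j / N)) *
        ∑ x ∈ Finset.range N, (φ ((x : ℝ) / N + (N : ℝ)⁻¹) - φ ((x : ℝ) / N)) *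
          Complex.exp (-(2 * π * Complex.I * j * x / N)) =
      (1 - Complex.exp (-(2 * π * Complex.I * j / N))) *
        ∑ x ∈ Finset.range N, φ ((x : ℝ) / N) *
          Complex.exp (-(2 * π * Complex.I * j * x / N)) := by
  set ω := Complex.exp (-(2 * π * Complex.I * j / N))
  have hN' : (N : ℂ) ≠ 0 := Nat.cast_ne_zero.mpr hN
  have hNr : (N : ℝ) ≠ 0 := Nat.cast_ne_zero.mpr hN
  let f : ℕ → ℂ := fun x => φ ((x : ℝ) / N) * Complex.exp (-(2 * π * Complex.I * j * x / N))
  have hend : f N = f 0 := by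
    have h1 : φ 1 = φ 0 := by simpa using hp 0
    have h2 : Complex.exp (-(2 * π * Complex.I * j * N / N)) = 1 := by
      rw [mul_div_cancel_right₀ _ hN', Complex.exp_eq_one_iff]
      exact ⟨-j, by push_cast; ring⟩
    simp only [f]
    rw [h2, div_self hNr, h1]
    simp
  have hshift : ∑ x ∈ Finset.range N, f (x + 1) = ∑ x ∈ Finset.range N, f x := by
    have h := (Finset.sum_range_succ' f N).symm.trans (Finset.sum_range_succ f N)
    rw [hend] at h
    exact add_right_cancel h
  have hstep : ∀ x : ℕ, f (x + 1) = ω * (φ ((x : ℝ) / N + (N : ℝ)⁻¹) *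
      Complex.exp (-(2 * π * Complex.I * j * x / N))) := by
    intro x
    have h1 : Complex.exp (-(2 * π * Complex.I * j * (x + 1 : ℕ) / N)) =
        ω * Complex.exp (-(2 * π * Complex.I * j * x / N)) := by
      rw [← Complex.exp_add]
      congr 1
      push_cast
      ring
    have h2 : (((x + 1 : ℕ) : ℝ) / N) = (x : ℝ) / N + (N : ℝ)⁻¹ := by
      push_cast
      ring
    simp only [f]
    rw [h1, h2]
    ring
  simp only [sub_mul, Finset.sum_sub_distrib, mul_sub, one_mul]
  congr 1
  rw [Finset.mul_sum, ← Finset.sum_congr rfl fun x _ => hstep x, hshift]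

/-- The frequency factor produced by one summation by parts. -/
theorem four_mul_abs_div_le_norm_one_sub_exp {N : ℕ} (hN : N ≠ 0) {j : ℤ}
    (hj : |(j : ℝ)| ≤ N / 2) :
    4 * |(j : ℝ)| / N ≤ ‖1 - Complex.exp (-(2 * π * Complex.I * j / N))‖ := by
  have hNr : (0 : ℝ) < N := by exact_mod_cast Nat.pos_of_ne_zero hN
  have hθ : |-(2 * π * j / N)| = 2 * π * |(j : ℝ)| / N := by
    rw [abs_neg, abs_div, abs_mul, abs_of_pos two_pi_pos, Nat.abs_cast]
  have h := two_div_pi_mul_abs_le_norm_exp_sub_one (θ := -(2 * π * j / N)) (by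
    rw [hθ, div_le_iff₀ hNr]
    nlinarith [pi_pos])
  rw [hθ, norm_sub_rev] at h
  have hexp : Complex.I * ((-(2 * π * j / N) : ℝ) : ℂ) = -(2 * π * Complex.I * j / N) := by
    push_cast
    ring
  rw [hexp] at h
  refine le_trans (le_of_eq ?_) h
  field_simp
  ring

theorem norm_discrete_fourier_sum_le {N : ℕ} (hN : N ≠ 0) {j : ℤ} (hj0 : j ≠ 0)
    (hj : |(j : ℝ)| ≤ N / 2) (k : ℕ) {φ : ℝ → ℂ} (hφ : ContDiff ℝ k φ)
    (hp : Function.Periodic φ 1) {M : ℝ} (hM : ∀ x, ‖iteratedDeriv k φ x‖ ≤ M) :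
    ‖∑ x ∈ Finset.range N, φ ((x : ℝ) / N) *
        Complex.exp (-(2 * π * Complex.I * j * x / N))‖ ≤ N * M / (4 * |(j : ℝ)|) ^ k := by
  have hNr : (0 : ℝ) < N := by exact_mod_cast Nat.pos_of_ne_zero hN
  have hjr : 0 < |(j : ℝ)| := abs_pos.mpr (Int.cast_ne_zero.mpr hj0)
  have hunit : ∀ z : ℝ, ‖Complex.exp (-(2 * π * Complex.I * j * z / N))‖ = 1 := by
    intro z
    rw [show -(2 * π * Complex.I * j * z / N) = ((-(2 * π * j * z / N) : ℝ) : ℂ) * Complex.I by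
      push_cast
      ring, Complex.norm_exp_ofReal_mul_I]
  induction k generalizing φ M with
  | zero =>
    simp only [pow_zero, div_one]
    have hconst : ∑ _x ∈ Finset.range N, M = N * M := by simp
    rw [← hconst]
    refine norm_sum_le_of_le _ fun x _ => ?_
    rw [norm_mul, ← Complex.ofReal_natCast x, hunit, mul_one]
    simpa using hM (x / N)
  | succ k ih =>
    have hφk : ContDiff ℝ k φ := hφ.of_le (by exact_mod_cast k.le_succ)
    have hshiftC : ContDiff ℝ k fun x => φ (x + (N : ℝ)⁻¹) :=
      hφk.comp (contDiff_id.add contDiff_const)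
    have hdiff : Differentiable ℝ (iteratedDeriv k φ) :=
      hφ.differentiable_iteratedDeriv k (by exact_mod_cast k.lt_succ_self)
    have hΔ := ih (φ := fun x => φ (x + (N : ℝ)⁻¹) - φ x) (M := M / N) (hshiftC.sub hφk)
      (fun x => by
        show φ (x + 1 + (N : ℝ)⁻¹) - φ (x + 1) = φ (x + (N : ℝ)⁻¹) - φ x
        rw [add_right_comm, hp, hp])
      (fun x => by
        have hsub := iteratedDeriv_fun_sub (n := k) (x := x) hshiftC.contDiffAt hφk.contDiffAt
        rw [hsub, congrFun (iteratedDeriv_comp_add_const k φ (N : ℝ)⁻¹) x]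
        have hmv := convex_univ.norm_image_sub_le_of_norm_deriv_le (f := iteratedDeriv k φ)
          (C := M) (x := x) (y := x + (N : ℝ)⁻¹) (fun z _ => hdiff z)
          (fun z _ => by rw [← iteratedDeriv_succ]; exact hM z) trivial trivial
        rwa [add_sub_cancel_left, Real.norm_of_nonneg (by positivity), ← div_eq_mul_inv] at hmv)
    have hparts := congrArg norm (discrete_fourier_sum_forward_difference hp hN j)
    have hω := hunit 1
    rw [Complex.ofReal_one, mul_one] at hω
    rw [norm_mul, norm_mul, hω, one_mul] at hparts
    rw [hparts] at hΔ
    have hmul := (mul_le_mul_of_nonneg_right (four_mul_abs_div_le_norm_one_sub_exp hN hj)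
      (norm_nonneg _)).trans hΔ
    rw [mul_div_cancel₀ _ hNr.ne', div_mul_eq_mul_div, div_le_iff₀ hNr] at hmul
    rw [le_div_iff₀ (by positivity), pow_succ]
    rw [div_mul_eq_mul_div, le_div_iff₀ (by positivity)] at hmul
    linarith

/-- **Decay of discrete Fourier coefficients**: for each `k ∈ ℕ` there is `C_k`
such that for every `φ ∈ C^k(𝕋,ℂ)`, every `N ≥ 1` and every integer `j` with
`1 ≤ |j| ≤ N/2`,
`N^{-1/2} ‖∑_{x=0}^{N-1} φ(x/N) e^{-2πijx/N}‖ ≤ C_k ‖φ‖_{C^k} √N / |j|^k`. -/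
theorem discrete_fourier_decay (k : ℕ) :
    ∃ C : ℝ, 0 < C ∧
      ∀ (φ : ℝ → ℂ), ContDiff ℝ k φ → Function.Periodic φ 1 →
      ∀ (N : ℕ), 1 ≤ N → ∀ j : ℤ, 1 ≤ |j| → (|j| : ℝ) ≤ (N : ℝ) / 2 →
        (Real.sqrt N)⁻¹ *
            ‖∑ x ∈ Finset.range N,
                φ ((x : ℝ) / N) * Complex.exp (-(2 * Real.pi * Complex.I * j * x / N))‖
          ≤ C * cknormC k φ * Real.sqrt N / (|j| : ℝ) ^ k := by
  refine ⟨1, one_pos, fun φ hφ hp N hN j hj1 hj => ?_⟩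
  have hNr : (0 : ℝ) < N := by exact_mod_cast hN
  have hj0 : j ≠ 0 := by
    rintro rfl
    simp at hj1
  have hjr : 0 < |(j : ℝ)| := abs_pos.mpr (Int.cast_ne_zero.mpr hj0)
  have hbound := norm_iteratedDeriv_le_cknormC hφ hp
  have hnonneg : 0 ≤ cknormC k φ := (norm_nonneg _).trans (hbound 0)
  have hsum := norm_discrete_fourier_sum_le (by omega) hj0 hj k hφ hp hbound
  have hweak : (N : ℝ) * cknormC k φ / (4 * |(j : ℝ)|) ^ k ≤ N * cknormC k φ / |(j : ℝ)| ^ k := by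
    gcongr
    linarith
  refine (mul_le_mul_of_nonneg_left (hsum.trans hweak) (by positivity)).trans (le_of_eq ?_)
  rw [one_mul, inv_mul_eq_div, div_div, div_eq_div_iff (by positivity) (by positivity)]
  linear_combination (-(cknormC k φ * |(j : ℝ)| ^ k)) * Real.sq_sqrt hNr.le

end
end

section
/- Density of preimages for expanding circle maps: Let f : 𝕋 → 𝕋 be a C² map of the circle 𝕋 = ℝ/ℤ with f' ≥ λ for some λ > 1. Then for every x̄ ∈ 𝕋 the set of all preimages ⋃_{n∈ℕ} f^{−n}(x̄) is dense in 𝕋. -/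
/-!
Statement 13: Density of preimages for expanding circle maps (Lemma A.1):
if `f : 𝕋 → 𝕋` is `C²` with `f' ≥ λ > 1`, then for every `x̄ ∈ 𝕋` the set
`⋃_n f^{-n}(x̄)` is dense in `𝕋`.  The circle map is given by a lift
`F : ℝ → ℝ` with `F(x+1) = F(x) + d` and the induced map
`fc : 𝕋 → 𝕋` satisfies `fc ∘ π = π ∘ F`.
-/

noncomputable section

/-- An expanding differentiable map has expanding iterates. -/
theorem pow_mul_sub_le_iterate_sub {F : ℝ → ℝ} (hF : Differentiable ℝ F) {lam : ℝ}
    (hlam : 0 ≤ lam) (hexp : ∀ x, lam ≤ deriv F x) (n : ℕ) {a b : ℝ} (hab : a ≤ b) :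
    lam ^ n * (b - a) ≤ F^[n] b - F^[n] a := by
  induction n generalizing a b with
  | zero => simp
  | succ n ih =>
    have h := mul_sub_le_image_sub_of_le_deriv hF hexp hab
    have hFab : F a ≤ F b := by nlinarith [mul_nonneg hlam (sub_nonneg.2 hab)]
    calc lam ^ (n + 1) * (b - a) = lam ^ n * (lam * (b - a)) := by ring
      _ ≤ lam ^ n * (F b - F a) := by gcongr
      _ ≤ F^[n + 1] b - F^[n + 1] a := ih hFab

/-- Every point of the unit circle is hit by a continuous lift on an interval
whose image has length at least one. -/
theorem exists_mem_Icc_coe_eq {G : ℝ → ℝ} (hG : Continuous G) {a b : ℝ} (hab : a ≤ b)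
    (h : G a + 1 ≤ G b) (x : UnitAddCircle) :
    ∃ p ∈ Set.Icc a b, ((G p : ℝ) : UnitAddCircle) = x := by
  obtain ⟨z, hz, rfl⟩ : x ∈ ((↑) : ℝ → UnitAddCircle) '' Set.Icc (G a) (G a + 1) := by
    rw [AddCircle.coe_image_Icc_eq]
    trivial
  obtain ⟨p, hp, rfl⟩ := intermediate_value_Icc hab hG.continuousOn ⟨hz.1, hz.2.trans h⟩
  exact ⟨p, hp, rfl⟩

/-- **Density of preimages for expanding circle maps**. -/
theorem dense_preimages_expanding
    (F : ℝ → ℝ) (hF : ContDiff ℝ 2 F) (d : ℤ) (hFlift : ∀ x, F (x + 1) = F x + d)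
    (lam : ℝ) (hlam : 1 < lam) (hexp : ∀ x, lam ≤ deriv F x)
    (fc : UnitAddCircle → UnitAddCircle)
    (hfc : ∀ x : ℝ, fc (x : UnitAddCircle) = ((F x : ℝ) : UnitAddCircle)) :
    ∀ xbar : UnitAddCircle,
      Dense {y : UnitAddCircle | ∃ n : ℕ, fc^[n] y = xbar} := by
  intro xbar
  rw [dense_iff_inter_open]
  rintro U hU ⟨y, hy⟩
  obtain ⟨t, rfl⟩ := QuotientAddGroup.mk_surjective y
  obtain ⟨ε, hε, hball⟩ := Metric.isOpen_iff.1
    (hU.preimage (AddCircle.continuous_mk' 1)) t hy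
  obtain ⟨n, hn⟩ := pow_unbounded_of_one_lt (ε / 2)⁻¹ hlam
  have hlen : 1 ≤ lam ^ n * (t + ε / 2 - t) := by
    rw [add_sub_cancel_left]
    exact ((inv_lt_iff_one_lt_mul₀ (half_pos hε)).1 hn).le
  have hab : t ≤ t + ε / 2 := by linarith
  have hgrow := pow_mul_sub_le_iterate_sub (hF.differentiable (by norm_num))
    (zero_le_one.trans hlam.le) hexp n hab
  obtain ⟨p, hp, hpx⟩ := exists_mem_Icc_coe_eq (hF.continuous.iterate n) hab
    (by linarith) xbar
  have hsemi : Function.Semiconj ((↑) : ℝ → UnitAddCircle) F fc := fun x => (hfc x).symm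
  refine ⟨(p : UnitAddCircle), hball ?_, n, ?_⟩
  · rw [Metric.mem_ball, Real.dist_eq, abs_lt]
    constructor <;> linarith [hp.1, hp.2]
  · rw [← hsemi.iterate_right n p, hpx]

end
end

section
/- Existence and uniqueness of a smooth invariant density for expanding circle maps: Let f : 𝕋 → 𝕋 be a C^∞ map of the circle 𝕋 = ℝ/ℤ with f' ≥ λ for some λ > 1. Then there exists exactly one f-invariant Borel probability measure on 𝕋 that is absolutely continuous with respect to Lebesgue measure; moreover its density ρ⋆ can be chosen C¹ and strictly positive on 𝕋, and it satisfies ∫_𝕋 ρ⋆(θ)·g(f(θ)) dθ = ∫_𝕋 ρ⋆(θ)·g(θ) dθ for all continuous g. -/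
/-!
Statement 14: Existence and uniqueness of a smooth invariant density for
expanding circle maps: a `C^∞` circle map with `f' ≥ λ > 1` has exactly one
absolutely continuous invariant Borel probability measure; its density `ρ⋆` can
be chosen `C¹` and strictly positive, and it satisfies
`∫ ρ⋆ (g∘f) = ∫ ρ⋆ g` for every continuous `g`.
-/

open MeasureTheory

noncomputable section

/-- `G` is the inverse of a lift `F` of a degree `d` expanding circle map, `w` and `w'` are its first
and second derivatives, `κ < 1` bounds `w` and `B` bounds the distortion `|w'| / w`. -/
structure ExpandingInverse (F G w w' : ℝ → ℝ) (d : ℕ) (κ B : ℝ) : Prop where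
  left_inv : ∀ x, G (F x) = x
  right_inv : ∀ y, F (G y) = y
  map_one : F 1 = F 0 + d
  hasDerivAt : ∀ y, HasDerivAt G (w y) y
  hasDerivAt_weight : ∀ y, HasDerivAt w (w' y) y
  continuous_deriv_weight : Continuous w'
  weight_pos : ∀ y, 0 < w y
  weight_le : ∀ y, w y ≤ κ
  ratio_lt_one : κ < 1
  abs_deriv_weight_le : ∀ y, |w' y| ≤ B * w y
  map_add_degree : ∀ y, G (y + d) = G y + 1
  weight_add_degree : ∀ y, w (y + d) = w y

/-- The transfer operator `ψ ↦ ∑ₖ w (y + k) ψ (G (y + k))`. -/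
def transfer (G w : ℝ → ℝ) (d : ℕ) : (ℝ → ℝ) →ₗ[ℝ] (ℝ → ℝ) where
  toFun ψ y := ∑ k ∈ Finset.range d, w (y + k) * ψ (G (y + k))
  map_add' ψ φ := by
    ext y; simp [mul_add, Finset.sum_add_distrib]
  map_smul' c ψ := by
    ext y
    simp only [Pi.smul_apply, smul_eq_mul, RingHom.id_apply, Finset.mul_sum]
    exact Finset.sum_congr rfl fun k _ => by ring

lemma transfer_apply (G w : ℝ → ℝ) (d : ℕ) (ψ : ℝ → ℝ) (y : ℝ) :
    transfer G w d ψ y = ∑ k ∈ Finset.range d, w (y + k) * ψ (G (y + k)) := rfl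

/-- Probability densities on the circle whose logarithmic derivative is bounded by `a`. -/
structure LogLipschitzDensity (a : ℝ) (ψ : ℝ → ℝ) : Prop where
  contDiff : ContDiff ℝ 1 ψ
  periodic : Function.Periodic ψ 1
  abs_deriv_le : ∀ x, |deriv ψ x| ≤ a * ψ x
  integral_eq_one : ∫ x in (0 : ℝ)..1, ψ x = 1

namespace LogLipschitzDensity

variable {a : ℝ} {ψ : ℝ → ℝ}

lemma continuous (h : LogLipschitzDensity a ψ) : Continuous ψ := h.contDiff.continuous

lemma hasDerivAt (h : LogLipschitzDensity a ψ) (x : ℝ) : HasDerivAt ψ (deriv ψ x) x :=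
  (h.contDiff.differentiable one_ne_zero x).hasDerivAt

lemma integral_unit (h : LogLipschitzDensity a ψ) (y : ℝ) : ∫ x in (y - 1)..y, ψ x = 1 := by
  have := h.periodic.intervalIntegral_add_eq (y - 1) 0
  simpa [h.integral_eq_one] using this

lemma nonneg (ha : 0 < a) (h : LogLipschitzDensity a ψ) (x : ℝ) : 0 ≤ ψ x :=
  nonneg_of_mul_nonneg_right ((abs_nonneg _).trans (h.abs_deriv_le x)) ha

lemma monotone_exp_mul (h : LogLipschitzDensity a ψ) :
    Monotone fun x => Real.exp (a * x) * ψ x := by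
  have hd (x : ℝ) : HasDerivAt (fun x => Real.exp (a * x) * ψ x)
      (Real.exp (a * x) * (a * 1) * ψ x + Real.exp (a * x) * deriv ψ x) x :=
    (((hasDerivAt_id x).const_mul a).exp).mul (h.hasDerivAt x)
  refine monotone_of_deriv_nonneg (fun x => (hd x).differentiableAt) fun x => ?_
  rw [(hd x).deriv, mul_one, mul_assoc, ← mul_add]
  have := (abs_le.1 (h.abs_deriv_le x)).1
  exact mul_nonneg (Real.exp_pos _).le (by linarith)

lemma antitone_exp_mul (h : LogLipschitzDensity a ψ) :
    Antitone fun x => Real.exp (-a * x) * ψ x := by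
  have hd (x : ℝ) : HasDerivAt (fun x => Real.exp (-a * x) * ψ x)
      (Real.exp (-a * x) * (-a * 1) * ψ x + Real.exp (-a * x) * deriv ψ x) x :=
    (((hasDerivAt_id x).const_mul (-a)).exp).mul (h.hasDerivAt x)
  refine antitone_of_deriv_nonpos (fun x => (hd x).differentiableAt) fun x => ?_
  rw [(hd x).deriv, mul_one, mul_assoc, ← mul_add]
  have := (abs_le.1 (h.abs_deriv_le x)).2
  exact mul_nonpos_of_nonneg_of_nonpos (Real.exp_pos _).le (by linarith)

lemma exp_neg_le (ha : 0 < a) (h : LogLipschitzDensity a ψ) (y : ℝ) : Real.exp (-a) ≤ ψ y := by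
  have key : ∀ x ∈ Set.Icc (y - 1) y, ψ x ≤ Real.exp a * ψ y := fun x hx => by
    have h1 : Real.exp (a * x) * ψ x ≤ Real.exp (a * y) * ψ y := h.monotone_exp_mul hx.2
    have h2 : Real.exp (a * y) ≤ Real.exp (a * x) * Real.exp a := by
      rw [← Real.exp_add]
      exact Real.exp_le_exp.2 (by nlinarith [hx.1])
    have h3 := mul_le_mul_of_nonneg_right h2 (h.nonneg ha y)
    rw [mul_assoc] at h3
    exact le_of_mul_le_mul_left (h1.trans h3) (Real.exp_pos _)
  have hi := intervalIntegral.integral_mono_on (μ := volume) (by linarith)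
    (h.continuous.intervalIntegrable (y - 1) y) (continuous_const.intervalIntegrable _ _) key
  rw [h.integral_unit] at hi
  simp only [intervalIntegral.integral_const, sub_sub_cancel, smul_eq_mul, one_mul] at hi
  rw [Real.exp_neg]
  exact (inv_le_iff_one_le_mul₀' (Real.exp_pos a)).2 hi

lemma le_exp (ha : 0 < a) (h : LogLipschitzDensity a ψ) (y : ℝ) : ψ y ≤ Real.exp a := by
  have key : ∀ x ∈ Set.Icc (y - 1) y, ψ y ≤ Real.exp a * ψ x := fun x hx => by
    have h1 : Real.exp (-a * y) * ψ y ≤ Real.exp (-a * x) * ψ x := h.antitone_exp_mul hx.2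
    have h2 : Real.exp (-a * x) ≤ Real.exp (-a * y) * Real.exp a := by
      rw [← Real.exp_add]
      exact Real.exp_le_exp.2 (by nlinarith [hx.1])
    have h3 := mul_le_mul_of_nonneg_right h2 (h.nonneg ha x)
    rw [mul_assoc] at h3
    exact le_of_mul_le_mul_left (h1.trans h3) (Real.exp_pos _)
  have hi := intervalIntegral.integral_mono_on (μ := volume) (by linarith)
    (continuous_const.intervalIntegrable _ _)
    ((h.continuous.const_mul _).intervalIntegrable (y - 1) y) key
  simpa [h.integral_unit] using hi

lemma pos (ha : 0 < a) (h : LogLipschitzDensity a ψ) (y : ℝ) : 0 < ψ y :=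
  (Real.exp_pos _).trans_le (h.exp_neg_le ha y)

lemma one (ha : 0 < a) : LogLipschitzDensity a fun _ => 1 where
  contDiff := contDiff_const
  periodic _ := rfl
  abs_deriv_le _ := by simpa using ha.le
  integral_eq_one := by simp

end LogLipschitzDensity

namespace ExpandingInverse

variable {F G w w' : ℝ → ℝ} {d : ℕ} {κ B a : ℝ} {ψ : ℝ → ℝ}

lemma continuous (h : ExpandingInverse F G w w' d κ B) : Continuous G :=
  continuous_iff_continuousAt.2 fun y => (h.hasDerivAt y).continuousAt

lemma continuous_weight (h : ExpandingInverse F G w w' d κ B) : Continuous w :=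
  continuous_iff_continuousAt.2 fun y => (h.hasDerivAt_weight y).continuousAt

lemma strictMono (h : ExpandingInverse F G w w' d κ B) : StrictMono G :=
  strictMono_of_deriv_pos fun y => (h.hasDerivAt y).deriv ▸ h.weight_pos y

lemma transfer_periodic (h : ExpandingInverse F G w w' d κ B) (hψ : Function.Periodic ψ 1) :
    Function.Periodic (transfer G w d ψ) 1 := fun y => by
  let u : ℕ → ℝ := fun k => w (y + k) * ψ (G (y + k))
  have h1 : transfer G w d ψ (y + 1) = ∑ k ∈ Finset.range d, u (k + 1) := by
    rw [transfer_apply]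
    refine Finset.sum_congr rfl fun k _ => ?_
    simp only [u]
    push_cast
    rw [show y + 1 + (k : ℝ) = y + (k + 1) by ring]
  have h2 : u d = u 0 := by
    simp [u, h.weight_add_degree, h.map_add_degree, hψ (G y)]
  have h3 := (Finset.sum_range_succ' u d).symm.trans (Finset.sum_range_succ u d)
  rw [h2] at h3
  rw [h1, transfer_apply]
  exact add_right_cancel h3

lemma transfer_hasDerivAt (h : ExpandingInverse F G w w' d κ B) (hψ : ContDiff ℝ 1 ψ) (y : ℝ) :
    HasDerivAt (transfer G w d ψ) (∑ k ∈ Finset.range d,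
      (w' (y + k) * ψ (G (y + k)) + w (y + k) * (deriv ψ (G (y + k)) * w (y + k)))) y := by
  have : transfer G w d ψ = fun y => ∑ k ∈ Finset.range d, w (y + k) * ψ (G (y + k)) := rfl
  rw [this]
  refine HasDerivAt.fun_sum fun k _ => ?_
  exact ((h.hasDerivAt_weight (y + k)).comp_add_const y k).mul
    (((hψ.differentiable one_ne_zero (G (y + k))).hasDerivAt.comp (y + k)
      (h.hasDerivAt (y + k))).comp_add_const y k)

lemma transfer_contDiff (h : ExpandingInverse F G w w' d κ B) (hψ : ContDiff ℝ 1 ψ) :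
    ContDiff ℝ 1 (transfer G w d ψ) := by
  refine contDiff_one_iff_deriv.2
    ⟨fun y => (h.transfer_hasDerivAt hψ y).differentiableAt, ?_⟩
  rw [show deriv (transfer G w d ψ) = _ from funext fun y => (h.transfer_hasDerivAt hψ y).deriv]
  have := h.continuous
  have := h.continuous_weight
  have := h.continuous_deriv_weight
  have := hψ.continuous
  have := hψ.continuous_deriv le_rfl
  fun_prop

/-- The transfer operator is dual to composition with `F`. -/
lemma integral_mul_comp (h : ExpandingInverse F G w w' d κ B) (hψ : Continuous ψ)
    (hψp : Function.Periodic ψ 1) {g : ℝ → ℝ} (hg : ∀ a b, IntervalIntegrable g volume a b)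
    (hgp : Function.Periodic g 1) :
    ∫ x in (0 : ℝ)..1, ψ x * g (F x) = ∫ x in (0 : ℝ)..1, transfer G w d ψ x * g x := by
  have hcG := h.continuous
  have hcw := h.continuous_weight
  have himg : G '' Set.Ioc (F 0) (F 1) = Set.Ioc 0 1 := by
    ext x
    constructor
    · rintro ⟨y, hy, rfl⟩
      rw [← h.left_inv 0, ← h.left_inv 1]
      exact ⟨h.strictMono hy.1, h.strictMono.monotone hy.2⟩
    · intro hx
      rw [← h.left_inv 0, ← h.left_inv 1, ← h.left_inv x] at hx
      exact ⟨F x, ⟨h.strictMono.lt_iff_lt.1 hx.1, h.strictMono.le_iff_le.1 hx.2⟩, h.left_inv x⟩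
  have hF01 : F 0 ≤ F 1 := by rw [h.map_one]; simp
  have hi (a b : ℝ) : IntervalIntegrable (fun y => w y * ψ (G y) * g y) volume a b :=
    (hg a b).continuousOn_mul (by fun_prop)
  calc ∫ x in (0 : ℝ)..1, ψ x * g (F x)
      = ∫ y in F 0..F 1, w y * ψ (G y) * g y := by
        rw [intervalIntegral.integral_of_le zero_le_one, intervalIntegral.integral_of_le hF01,
          ← himg, integral_image_eq_integral_abs_deriv_smul measurableSet_Ioc
            (fun y _ => (h.hasDerivAt y).hasDerivWithinAt) h.strictMono.injective.injOn]
        simp [abs_of_pos (h.weight_pos _), h.right_inv, mul_assoc]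
    _ = ∑ k ∈ Finset.range d, ∫ y in F 0 + k..F 0 + (k + 1 : ℕ), w y * ψ (G y) * g y := by
        rw [intervalIntegral.sum_integral_adjacent_intervals (a := fun k : ℕ => F 0 + k)
          (fun k _ => hi _ _), h.map_one]
        simp
    _ = ∑ k ∈ Finset.range d, ∫ y in F 0..F 0 + 1, w (y + k) * ψ (G (y + k)) * g y := by
        refine Finset.sum_congr rfl fun k _ => ?_
        have := intervalIntegral.integral_comp_add_right (a := F 0) (b := F 0 + 1)
          (fun y => w y * ψ (G y) * g y) k
        rw [show F 0 + ((k + 1 : ℕ) : ℝ) = F 0 + 1 + k by push_cast; ring, ← this]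
        have hk (y : ℝ) : g (y + k) = g y := by simpa using hgp.nat_mul k y
        simp [hk]
    _ = ∫ y in F 0..F 0 + 1, transfer G w d ψ y * g y := by
        rw [← intervalIntegral.integral_finsetSum fun k _ =>
          (hg _ _).continuousOn_mul (by fun_prop)]
        simp [transfer_apply, Finset.sum_mul]
    _ = ∫ x in (0 : ℝ)..1, transfer G w d ψ x * g x := by
        have := ((h.transfer_periodic hψp).mul hgp).intervalIntegral_add_eq (F 0) 0
        simpa using this

lemma transfer_density (h : ExpandingInverse F G w w' d κ B)
    (ha : 0 < a) (haB : B + κ * a ≤ a - 1) (hψ : LogLipschitzDensity a ψ) :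
    LogLipschitzDensity a (transfer G w d ψ) ∧
      ∀ x, |deriv (transfer G w d ψ) x| ≤ (a - 1) * transfer G w d ψ x := by
  have hnn (x : ℝ) : 0 ≤ transfer G w d ψ x := by
    rw [transfer_apply]
    exact Finset.sum_nonneg fun k _ => mul_nonneg (h.weight_pos _).le (hψ.nonneg ha _)
  have hd (x : ℝ) : |deriv (transfer G w d ψ) x| ≤ (a - 1) * transfer G w d ψ x := by
    rw [(h.transfer_hasDerivAt hψ.contDiff x).deriv, transfer_apply, Finset.mul_sum]
    refine (Finset.abs_sum_le_sum_abs _ _).trans (Finset.sum_le_sum fun k _ => ?_)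
    have hw := h.weight_pos (x + k)
    have hp := hψ.nonneg ha (G (x + k))
    have hwp := mul_nonneg hw.le hp
    have e1 : |w' (x + k) * ψ (G (x + k))| ≤ B * (w (x + k) * ψ (G (x + k))) := by
      rw [abs_mul, abs_of_nonneg hp, ← mul_assoc]
      exact mul_le_mul_of_nonneg_right (h.abs_deriv_weight_le _) hp
    have e2 : |w (x + k) * (deriv ψ (G (x + k)) * w (x + k))| ≤
        κ * a * (w (x + k) * ψ (G (x + k))) := by
      rw [abs_mul, abs_mul, abs_of_pos hw]
      calc w (x + k) * (|deriv ψ (G (x + k))| * w (x + k))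
          ≤ w (x + k) * ((a * ψ (G (x + k))) * κ) := by
            gcongr
            · exact hψ.abs_deriv_le _
            · exact h.weight_le _
        _ = _ := by ring
    have e3 := mul_le_mul_of_nonneg_right haB hwp
    linarith [abs_add_le (w' (x + k) * ψ (G (x + k)))
      (w (x + k) * (deriv ψ (G (x + k)) * w (x + k)))]
  refine ⟨⟨h.transfer_contDiff hψ.contDiff, h.transfer_periodic hψ.periodic, fun x =>
    (hd x).trans (mul_le_mul_of_nonneg_right (by linarith) (hnn x)), ?_⟩, hd⟩
  have := h.integral_mul_comp hψ.continuous hψ.periodic (g := fun _ => 1) (by simp)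
    (fun _ => rfl)
  simpa [hψ.integral_eq_one] using this.symm

lemma exists_transfer_eq (h : ExpandingInverse F G w w' d κ B) (ha : 1 ≤ a)
    (haB : B + κ * a ≤ a - 1) :
    ∃ r : ℝ, 0 < r ∧ r < 1 ∧ ∀ ψ, LogLipschitzDensity a ψ →
      ∃ φ, LogLipschitzDensity a φ ∧ transfer G w d ψ = (fun _ => 1 - r) + r • φ := by
  have ha0 : 0 < a := by linarith
  have hea : 0 < Real.exp (-a) := Real.exp_pos _
  have hea1 : Real.exp (-a) < 1 := by simpa using ha0
  have hc0 : 0 < Real.exp (-a) / a := by positivity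
  have hc1 : Real.exp (-a) / a < 1 := (div_lt_one ha0).2 (by linarith)
  set c := Real.exp (-a) / a with hc
  have hac : a * c = Real.exp (-a) := by rw [hc]; field_simp
  have hr : 0 < 1 - c := by linarith
  refine ⟨1 - c, hr, by linarith, fun ψ hψ => ?_⟩
  obtain ⟨hL, hL'⟩ := h.transfer_density ha0 haB hψ
  refine ⟨fun x => (1 - c)⁻¹ * (transfer G w d ψ x - c), ⟨?_, fun x => ?_, fun x => ?_, ?_⟩, ?_⟩
  · exact contDiff_const.mul (hL.contDiff.sub contDiff_const)
  · simp only [hL.periodic x]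
  · rw [(((hL.hasDerivAt x).sub_const c).const_mul _).deriv, abs_mul,
      abs_of_pos (inv_pos.2 hr), mul_left_comm]
    refine mul_le_mul_of_nonneg_left ((hL' x).trans ?_) (inv_pos.2 hr).le
    have := hL.exp_neg_le ha0 x
    linarith
  · rw [intervalIntegral.integral_const_mul, intervalIntegral.integral_sub
      (hL.continuous.intervalIntegrable _ _) (continuous_const.intervalIntegrable _ _),
      hL.integral_eq_one]
    simp [hr.ne']
  · ext x
    simp [hr.ne']

lemma exists_iterate_sub_eq (h : ExpandingInverse F G w w' d κ B) (ha : 1 ≤ a)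
    (haB : B + κ * a ≤ a - 1) :
    ∃ r : ℝ, 0 < r ∧ r < 1 ∧ ∀ n : ℕ, ∀ ψ₁ ψ₂, LogLipschitzDensity a ψ₁ →
      LogLipschitzDensity a ψ₂ → ∃ φ₁ φ₂, LogLipschitzDensity a φ₁ ∧ LogLipschitzDensity a φ₂ ∧
        (transfer G w d ^ n) ψ₁ - (transfer G w d ^ n) ψ₂ = r ^ n • (φ₁ - φ₂) := by
  obtain ⟨r, hr0, hr1, hr⟩ := h.exists_transfer_eq ha haB
  refine ⟨r, hr0, hr1, fun n ψ₁ ψ₂ h₁ h₂ => ?_⟩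
  induction n with
  | zero => exact ⟨ψ₁, ψ₂, h₁, h₂, by simp⟩
  | succ n ih =>
    obtain ⟨φ₁, φ₂, hφ₁, hφ₂, e⟩ := ih
    obtain ⟨χ₁, hχ₁, e₁⟩ := hr φ₁ hφ₁
    obtain ⟨χ₂, hχ₂, e₂⟩ := hr φ₂ hφ₂
    refine ⟨χ₁, χ₂, hχ₁, hχ₂, ?_⟩
    rw [pow_succ', Module.End.mul_apply, Module.End.mul_apply, ← map_sub, e, map_smul, map_sub,
      e₁, e₂, add_sub_add_left_eq_sub, ← smul_sub, smul_smul, pow_succ]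

lemma iterate_density (h : ExpandingInverse F G w w' d κ B) (ha : 0 < a)
    (haB : B + κ * a ≤ a - 1) (hψ : LogLipschitzDensity a ψ) (n : ℕ) :
    LogLipschitzDensity a ((transfer G w d ^ n) ψ) := by
  induction n with
  | zero => simpa
  | succ n ih =>
    rw [pow_succ', Module.End.mul_apply]
    exact (h.transfer_density ha haB ih).1

/-- Exponential contraction of the transfer operator in the `C¹` topology. -/
lemma exists_abs_iterate_sub_le (h : ExpandingInverse F G w w' d κ B) (ha : 1 ≤ a)
    (haB : B + κ * a ≤ a - 1) :
    ∃ C r : ℝ, 0 < r ∧ r < 1 ∧ ∀ ψ₁ ψ₂, LogLipschitzDensity a ψ₁ →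
      LogLipschitzDensity a ψ₂ → ∀ (n : ℕ) (x : ℝ),
        |(transfer G w d ^ n) ψ₁ x - (transfer G w d ^ n) ψ₂ x| ≤ C * r ^ n ∧
        |deriv ((transfer G w d ^ n) ψ₁) x - deriv ((transfer G w d ^ n) ψ₂) x| ≤ C * r ^ n := by
  obtain ⟨r, hr0, hr1, hr⟩ := h.exists_iterate_sub_eq ha haB
  have ha0 : 0 < a := by linarith
  refine ⟨2 * a * Real.exp a, r, hr0, hr1, fun ψ₁ ψ₂ h₁ h₂ n x => ?_⟩
  obtain ⟨φ₁, φ₂, hφ₁, hφ₂, e⟩ := hr n ψ₁ ψ₂ h₁ h₂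
  have d₁ := (h.iterate_density ha0 haB h₁ n).hasDerivAt x
  have d₂ := (h.iterate_density ha0 haB h₂ n).hasDerivAt x
  have d₃ := ((hφ₁.hasDerivAt x).sub (hφ₂.hasDerivAt x)).const_smul (r ^ n)
  have ed := (d₁.sub d₂).unique (e ▸ d₃)
  have ex := congrFun e x
  simp only [Pi.sub_apply, Pi.smul_apply, smul_eq_mul] at ex ed
  have hrn : 0 < r ^ n := pow_pos hr0 n
  have l₁ := hφ₁.le_exp ha0 x
  have l₂ := hφ₂.le_exp ha0 x
  have p₁ := hφ₁.nonneg ha0 x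
  have p₂ := hφ₂.nonneg ha0 x
  have q₁ := abs_le.1 (hφ₁.abs_deriv_le x)
  have q₂ := abs_le.1 (hφ₂.abs_deriv_le x)
  rw [ed, ex, abs_mul, abs_mul, abs_of_pos hrn, mul_comm (2 * a * Real.exp a)]
  have m₁ := mul_le_mul_of_nonneg_left l₁ ha0.le
  have m₂ := mul_le_mul_of_nonneg_left l₂ ha0.le
  constructor <;> refine mul_le_mul_of_nonneg_left (abs_le.2 ?_) hrn.le
  · have := mul_le_mul_of_nonneg_right ha (Real.exp_pos a).le
    constructor <;> linarith
  · constructor <;> linarith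

/-- Existence of a fixed density of the transfer operator. -/
lemma exists_fixed_density (h : ExpandingInverse F G w w' d κ B) (ha : 1 ≤ a)
    (haB : B + κ * a ≤ a - 1) :
    ∃ ρ, LogLipschitzDensity a ρ ∧ transfer G w d ρ = ρ := by
  obtain ⟨C, r, hr0, hr1, hr⟩ := h.exists_abs_iterate_sub_le ha haB
  have ha0 : 0 < a := by linarith
  have h1 := LogLipschitzDensity.one ha0
  have hL1 := (h.transfer_density ha0 haB h1).1
  set L := transfer G w d with hL
  let u : ℕ → ℝ → ℝ := fun n => (L ^ n) fun _ => 1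
  have hu (n : ℕ) : LogLipschitzDensity a (u n) := h.iterate_density ha0 haB h1 n
  have husucc (n : ℕ) : (L ^ n) (L fun _ => 1) = u (n + 1) := by
    simp only [u, pow_succ, Module.End.mul_apply]
  have husucc' (n : ℕ) : L (u n) = u (n + 1) := by
    simp only [u, pow_succ', Module.End.mul_apply]
  have hdist (n : ℕ) (x : ℝ) : dist (u n x) (u (n + 1) x) ≤ C * r ^ n := by
    rw [dist_comm, ← husucc]
    exact (hr _ _ hL1 h1 n x).1
  have hdist' (n : ℕ) (x : ℝ) : dist (deriv (u n) x) (deriv (u (n + 1)) x) ≤ C * r ^ n := by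
    rw [dist_comm, ← husucc]
    exact (hr _ _ hL1 h1 n x).2
  choose ρ hρ using fun x => cauchySeq_tendsto_of_complete
    (cauchySeq_of_le_geometric r C hr1 fun n => hdist n x)
  choose χ hχ using fun x => cauchySeq_tendsto_of_complete
    (cauchySeq_of_le_geometric r C hr1 fun n => hdist' n x)
  have hlim : Filter.Tendsto (fun n : ℕ => C * r ^ n / (1 - r)) Filter.atTop (nhds 0) := by
    simpa using ((tendsto_pow_atTop_nhds_zero_of_lt_one hr0.le hr1).const_mul C).div_const (1 - r)
  have hunif : TendstoUniformly (fun n => deriv (u n)) χ Filter.atTop := by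
    refine Metric.tendstoUniformly_iff.2 fun ε hε => ?_
    filter_upwards [hlim.eventually_lt_const hε] with n hn x
    rw [dist_comm]
    exact (dist_le_of_le_geometric_of_tendsto r C hr1 (fun n => hdist' n x) (hχ x) n).trans_lt hn
  have hderiv (x : ℝ) : HasDerivAt ρ (χ x) x :=
    hasDerivAt_of_tendstoUniformly hunif
      (Filter.Eventually.of_forall fun n x => (hu n).hasDerivAt x) hρ x
  have hχc : Continuous χ := hunif.continuous
    (Filter.Frequently.of_forall fun n => (hu n).contDiff.continuous_deriv le_rfl)
  refine ⟨ρ, ⟨?_, fun x => ?_, fun x => ?_, ?_⟩, ?_⟩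
  · refine contDiff_one_iff_deriv.2 ⟨fun x => (hderiv x).differentiableAt, ?_⟩
    rwa [show deriv ρ = χ from funext fun x => (hderiv x).deriv]
  · refine tendsto_nhds_unique (hρ (x + 1)) ?_
    simpa only [(hu _).periodic x] using hρ x
  · rw [(hderiv x).deriv]
    exact le_of_tendsto_of_tendsto (hχ x).abs ((hρ x).const_mul a)
      (Filter.Eventually.of_forall fun n => (hu n).abs_deriv_le x)
  · have := intervalIntegral.tendsto_integral_filter_of_dominated_convergence
      (μ := volume) (a := 0) (b := 1) (l := Filter.atTop) (F := u) (f := ρ)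
      (fun _ => Real.exp a)
      (Filter.Eventually.of_forall fun n => (hu n).continuous.aestronglyMeasurable)
      (Filter.Eventually.of_forall fun n => Filter.Eventually.of_forall fun x _ => by
        rw [Real.norm_of_nonneg ((hu n).nonneg ha0 x)]
        exact (hu n).le_exp ha0 x)
      (continuous_const.intervalIntegrable _ _)
      (Filter.Eventually.of_forall fun x _ => hρ x)
    simp only [(hu _).integral_eq_one] at this
    exact tendsto_nhds_unique this tendsto_const_nhds
  · ext x
    refine tendsto_nhds_unique (f := fun n => L (u n) x) (l := Filter.atTop) ?_ ?_
    · simp only [hL, transfer_apply]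
      exact tendsto_finsetSum _ fun k _ => (hρ _).const_mul _
    · simpa only [husucc', Function.comp_def] using (hρ x).comp (Filter.tendsto_add_atTop_nat 1)

/-- Integrating regular densities against an invariant function gives a constant result. -/
lemma integral_mul_eq_of_invariant (h : ExpandingInverse F G w w' d κ B) (ha : 1 ≤ a)
    (haB : B + κ * a ≤ a - 1) {φ : ℝ → ℝ} (hψ : LogLipschitzDensity a ψ)
    (hφ : LogLipschitzDensity a φ) {g : ℝ → ℝ} (hg : ∀ a b, IntervalIntegrable g volume a b)
    (hg1 : ∀ x, |g x| ≤ 1) (hgp : Function.Periodic g 1) (hgF : ∀ x, g (F x) = g x) :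
    ∫ x in (0 : ℝ)..1, ψ x * g x = ∫ x in (0 : ℝ)..1, φ x * g x := by
  obtain ⟨C, r, hr0, hr1, hr⟩ := h.exists_abs_iterate_sub_le ha haB
  have ha0 : 0 < a := by linarith
  have hiter {ψ : ℝ → ℝ} (hψ : LogLipschitzDensity a ψ) (n : ℕ) :
      ∫ x in (0 : ℝ)..1, (transfer G w d ^ n) ψ x * g x = ∫ x in (0 : ℝ)..1, ψ x * g x := by
    induction n with
    | zero => simp
    | succ n ih =>
      have hn := h.iterate_density ha0 haB hψ n
      have := h.integral_mul_comp hn.continuous hn.periodic hg hgp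
      rw [pow_succ', Module.End.mul_apply, ← this, ← ih]
      simp only [hgF]
  have hle (n : ℕ) : ‖(∫ x in (0 : ℝ)..1, ψ x * g x) - ∫ x in (0 : ℝ)..1, φ x * g x‖ ≤
      C * r ^ n := by
    rw [← hiter hψ n, ← hiter hφ n, ← intervalIntegral.integral_sub
      ((hg 0 1).continuousOn_mul (h.iterate_density ha0 haB hψ n).continuous.continuousOn)
      ((hg 0 1).continuousOn_mul (h.iterate_density ha0 haB hφ n).continuous.continuousOn)]
    refine (intervalIntegral.norm_integral_le_of_norm_le_const (C := C * r ^ n)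
      fun x _ => ?_).trans (by simp)
    rw [← sub_mul, Real.norm_eq_abs, abs_mul]
    exact (mul_le_of_le_one_right (abs_nonneg _) (hg1 x)).trans (hr ψ φ hψ hφ n x).1
  have hlim : Filter.Tendsto (fun n : ℕ => C * r ^ n) Filter.atTop (nhds 0) := by
    simpa using (tendsto_pow_atTop_nhds_zero_of_lt_one hr0.le hr1).const_mul C
  exact sub_eq_zero.1 (norm_le_zero_iff.1 (ge_of_tendsto' hlim hle))

end ExpandingInverse

/-- A bounded measurable function on the circle which annihilates all `C¹` functions vanishes. -/
lemma ae_eq_zero_of_forall_integral_mul_eq_zero {g : UnitAddCircle → ℝ} (hg : Measurable g)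
    {C : ℝ} (hC : ∀ u, |g u| ≤ C)
    (h : ∀ φ : ℝ → ℝ, ContDiff ℝ 1 φ → Function.Periodic φ 1 →
      ∫ x in (0 : ℝ)..1, φ x * g x = 0) :
    g =ᵐ[volume] 0 := by
  have hvol : (volume : Measure UnitAddCircle) = AddCircle.haarAddCircle := by
    simp [AddCircle.volume_eq_smul_haarAddCircle]
  have hmem : MemLp (fun u => (g u : ℂ)) 2 (AddCircle.haarAddCircle (T := (1 : ℝ))) :=
    MemLp.of_bound (Complex.measurable_ofReal.comp hg).aestronglyMeasurable C
      (Filter.Eventually.of_forall fun u => by simpa using hC u)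
  have hgi : IntervalIntegrable (fun x : ℝ => (g x : ℂ)) volume 0 1 := by
    refine (continuous_const (y := C)).intervalIntegrable 0 1 |>.mono_fun'
      (Complex.measurable_ofReal.comp
        (hg.comp AddCircle.measurable_mk')).aestronglyMeasurable ?_
    exact Filter.Eventually.of_forall fun x => by simpa using hC x
  have hcoeff (n : ℤ) : fourierCoeff (fun u : UnitAddCircle => (g u : ℂ)) n = 0 := by
    have hcd : ContDiff ℝ 1 fun x : ℝ => (fourier (-n) (x : UnitAddCircle) : ℂ) := by
      simp only [fourier_coe_apply]
      have : ContDiff ℝ 1 fun x : ℝ => (x : ℂ) := Complex.ofRealCLM.contDiff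
      fun_prop
    have hfg : IntervalIntegrable
        (fun x : ℝ => (fourier (-n) (x : UnitAddCircle) : ℂ) * (g x : ℂ)) volume 0 1 :=
      hgi.continuousOn_mul hcd.continuous.continuousOn
    have hre := Complex.reCLM.intervalIntegral_comp_comm hfg
    have him := Complex.imCLM.intervalIntegral_comp_comm hfg
    simp only [Complex.reCLM_apply, Complex.imCLM_apply, Complex.re_mul_ofReal,
      Complex.im_mul_ofReal] at hre him
    rw [fourierCoeff_eq_intervalIntegral _ n 0]
    simp only [smul_eq_mul, zero_add, div_one, one_smul]
    refine Complex.ext (hre.symm.trans ?_) (him.symm.trans ?_)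
    · exact h _ (Complex.reCLM.contDiff.comp hcd) fun x => by
        rw [AddCircle.coe_add_period]
    · exact h _ (Complex.imCLM.contDiff.comp hcd) fun x => by
        rw [AddCircle.coe_add_period]
  have hsum := hasSum_fourier_series_L2 hmem.toLp
  have hcoeff' (n : ℤ) : fourierCoeff hmem.toLp n = 0 := by
    rw [← hcoeff n]
    refine integral_congr_ae ?_
    filter_upwards [hmem.coeFn_toLp] with u hu
    rw [hu]
  simp only [hcoeff', zero_smul] at hsum
  have hz := (hasSum_zero.unique hsum).symm
  rw [hvol]
  filter_upwards [hmem.coeFn_toLp, Lp.coeFn_zero ℂ 2 AddCircle.haarAddCircle] with u h₁ h₂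
  rw [hz, h₂] at h₁
  simpa using h₁.symm

/-- Every `C¹` periodic function becomes a multiple of a regular density after adding a constant. -/
lemma exists_logLipschitzDensity_add_const {a : ℝ} (ha : 0 < a) {φ : ℝ → ℝ} (hφ : ContDiff ℝ 1 φ)
    (hp : Function.Periodic φ 1) :
    ∃ K : ℝ, 0 < (∫ x in (0 : ℝ)..1, φ x) + K ∧
      LogLipschitzDensity a fun x => ((∫ x in (0 : ℝ)..1, φ x) + K)⁻¹ * (φ x + K) := by
  have hpd : Function.Periodic (deriv φ) 1 := fun x => by
    rw [← deriv_comp_add_const, show (fun x => φ (x + 1)) = φ from funext hp]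
  obtain ⟨M, hM⟩ := (hp.isBounded_of_continuous one_ne_zero
    hφ.continuous).exists_norm_le
  obtain ⟨M', hM'⟩ := (hpd.isBounded_of_continuous one_ne_zero
    (hφ.continuous_deriv le_rfl)).exists_norm_le
  replace hM (x : ℝ) : |φ x| ≤ M := hM _ ⟨x, rfl⟩
  replace hM' (x : ℝ) : |deriv φ x| ≤ M' := hM' _ ⟨x, rfl⟩
  have hM'0 : 0 ≤ M' := (abs_nonneg _).trans (hM' 0)
  have hK : 0 < (∫ x in (0 : ℝ)..1, φ x) + (M + M' / a + 1) := by
    have := intervalIntegral.norm_integral_le_of_norm_le_const (a := 0) (b := 1) (f := φ)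
      fun x _ => hM x
    simp only [Real.norm_eq_abs, sub_zero, abs_one, mul_one] at this
    have := (abs_le.1 this).1
    have : 0 ≤ M' / a := by positivity
    linarith
  refine ⟨M + M' / a + 1, hK, contDiff_const.mul (hφ.add contDiff_const), fun x => ?_,
    fun x => ?_, ?_⟩
  · simp only [hp x]
  · rw [((((hφ.differentiable one_ne_zero x).hasDerivAt).add_const _).const_mul _).deriv, abs_mul,
      abs_of_pos (inv_pos.2 hK), mul_left_comm]
    refine mul_le_mul_of_nonneg_left ((hM' x).trans ?_) (inv_pos.2 hK).le
    have h1 := (abs_le.1 (hM x)).1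
    have h2 : a * (M' / a) = M' := by field_simp
    nlinarith
  · rw [intervalIntegral.integral_const_mul, intervalIntegral.integral_add
      (hφ.continuous.intervalIntegrable _ _) (continuous_const.intervalIntegrable _ _)]
    simpa using inv_mul_cancel₀ hK.ne'

lemma intervalIntegrable_indicator_coe {s : Set UnitAddCircle} (hs : MeasurableSet s) (a b : ℝ) :
    IntervalIntegrable (fun x : ℝ => s.indicator (1 : UnitAddCircle → ℝ) x) volume a b := by
  refine (continuous_const (y := (1 : ℝ))).intervalIntegrable a b |>.mono_fun'
    ((measurable_one.indicator hs).comp AddCircle.measurable_mk').aestronglyMeasurable ?_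
  refine Filter.Eventually.of_forall fun x => ?_
  by_cases hx : (x : UnitAddCircle) ∈ s <;> simp [hx]

lemma withDensity_lift_apply {ρ : ℝ → ℝ} (hρ : Continuous ρ) (hper : Function.Periodic ρ 1)
    (hpos : ∀ x, 0 < ρ x) {s : Set UnitAddCircle} (hs : MeasurableSet s) :
    (volume : Measure UnitAddCircle).withDensity (fun u => ENNReal.ofReal (hper.lift u)) s =
      ENNReal.ofReal (∫ x in (0 : ℝ)..1, ρ x * s.indicator (1 : UnitAddCircle → ℝ) x) := by
  have hc : Continuous hper.lift := (QuotientAddGroup.isQuotientMap_mk _).continuous_iff.2 hρ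
  have hi : Integrable hper.lift (volume : Measure UnitAddCircle) :=
    hc.integrable_of_hasCompactSupport (HasCompactSupport.of_compactSpace _)
  have hnn (u : UnitAddCircle) : 0 ≤ hper.lift u := by
    induction u using QuotientAddGroup.induction_on with
    | H x => exact (hpos x).le
  rw [withDensity_apply _ hs, ← ofReal_integral_eq_lintegral_ofReal hi.restrict
    (Filter.Eventually.of_forall hnn), ← integral_indicator hs,
    ← UnitAddCircle.intervalIntegral_preimage 0, zero_add]
  congr 1
  refine intervalIntegral.integral_congr fun x _ => ?_
  by_cases hx : (x : UnitAddCircle) ∈ s <;> simp [hx]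

/-- The inverse of an expanding lift satisfies the standing assumptions. -/
lemma exists_expandingInverse {F : ℝ → ℝ} (hF : ContDiff ℝ 2 F) {d : ℤ}
    (hFlift : ∀ x, F (x + 1) = F x + d) {lam : ℝ} (hlam : 1 < lam)
    (hexp : ∀ x, lam ≤ deriv F x) :
    ∃ (G w w' : ℝ → ℝ) (n : ℕ) (B : ℝ), 0 ≤ B ∧ ExpandingInverse F G w w' n lam⁻¹ B := by
  have hpos (x : ℝ) : 0 < deriv F x := by linarith [hexp x]
  have hmono : StrictMono F := strictMono_of_deriv_pos hpos
  have hdiff : Differentiable ℝ F := hF.differentiable two_ne_zero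
  have hF' : ContDiff ℝ 1 (deriv F) := ((contDiff_succ_iff_deriv (n := 1)).1 hF).2.2
  have hF'd : Differentiable ℝ (deriv F) := hF'.differentiable one_ne_zero
  have hF''c : Continuous (deriv (deriv F)) := hF'.continuous_deriv le_rfl
  have hF'p : Function.Periodic (deriv F) 1 := fun x => by
    rw [← deriv_comp_add_const, show (fun x => F (x + 1)) = fun x => F x + d from funext hFlift,
      deriv_add_const]
  have hF''p : Function.Periodic (deriv (deriv F)) 1 := fun x => by
    rw [← deriv_comp_add_const, show (fun x => deriv F (x + 1)) = deriv F from funext hF'p]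
  obtain ⟨B, hB⟩ := (hF''p.isBounded_of_continuous one_ne_zero hF''c).exists_norm_le
  replace hB (x : ℝ) : |deriv (deriv F) x| ≤ B := hB _ ⟨x, rfl⟩
  have hB0 : 0 ≤ B := (abs_nonneg _).trans (hB 0)
  have hsub : Monotone fun x => F x - x := by
    refine monotone_of_deriv_nonneg (hdiff.sub differentiable_id) fun x => ?_
    rw [((hdiff x).hasDerivAt.fun_sub (hasDerivAt_id' x)).deriv]
    linarith [hexp x]
  have hsurj : Function.Surjective F := by
    refine hdiff.continuous.surjective ?_ ?_
    · refine Filter.tendsto_atTop_mono' _ ?_ (Filter.tendsto_atTop_add_const_right _ (F 0)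
        Filter.tendsto_id)
      filter_upwards [Filter.eventually_ge_atTop 0] with x hx
      have : F 0 - 0 ≤ F x - x := hsub hx
      simp only [id]
      linarith
    · refine Filter.tendsto_atBot_mono' _ ?_ (Filter.tendsto_atBot_add_const_right _ (F 0)
        Filter.tendsto_id)
      filter_upwards [Filter.eventually_le_atBot 0] with x hx
      have : F x - x ≤ F 0 - 0 := hsub hx
      simp only [id]
      linarith
  have hd : 0 ≤ d := by
    have h1 := hFlift 0
    have h2 : F 0 < F (0 + 1) := hmono (by norm_num)
    have : (0 : ℝ) < d := by linarith
    exact_mod_cast this.le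
  lift d to ℕ using hd
  let e := hmono.orderIsoOfSurjective F hsurj
  have hl (x : ℝ) : e.symm (F x) = x := e.symm_apply_apply x
  have hr (y : ℝ) : F (e.symm y) = y := e.apply_symm_apply y
  have hG (y : ℝ) : HasDerivAt e.symm (deriv F (e.symm y))⁻¹ y :=
    (hdiff _).hasDerivAt.of_local_left_inverse e.symm.continuous.continuousAt (hpos _).ne'
      (Filter.Eventually.of_forall hr)
  have hadd (y : ℝ) : e.symm (y + d) = e.symm y + 1 := by
    apply hmono.injective
    rw [hr, hFlift, hr]
    rfl
  have hle (y : ℝ) : (deriv F (e.symm y))⁻¹ ≤ lam⁻¹ := inv_anti₀ (by linarith) (hexp _)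
  have hw (y : ℝ) : HasDerivAt (fun y => (deriv F (e.symm y))⁻¹)
      (-(deriv (deriv F) (e.symm y) * (deriv F (e.symm y))⁻¹) / deriv F (e.symm y) ^ 2) y :=
    ((hF'd _).hasDerivAt.comp y (hG y)).fun_inv (hpos _).ne'
  have hGc : Continuous e.symm := e.symm.continuous
  refine ⟨e.symm, fun y => (deriv F (e.symm y))⁻¹, _, d, B, hB0,
    { left_inv := hl
      right_inv := hr
      map_one := by simpa using hFlift 0
      hasDerivAt := hG
      hasDerivAt_weight := hw
      continuous_deriv_weight := ?_
      weight_pos := fun y => inv_pos.2 (hpos _)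
      weight_le := hle
      ratio_lt_one := inv_lt_one_of_one_lt₀ hlam
      abs_deriv_weight_le := fun y => ?_
      map_add_degree := hadd
      weight_add_degree := fun y => by simp only [hadd, hF'p _] }⟩
  · have h1 : Continuous fun y => deriv F (e.symm y) := hF'.continuous.comp hGc
    have h2 : Continuous fun y => deriv (deriv F) (e.symm y) := hF''c.comp hGc
    exact ((h2.mul (h1.inv₀ fun y => (hpos _).ne')).neg).div (h1.pow 2)
      fun y => (pow_pos (hpos _) 2).ne'
  · have h1 : 1 ≤ deriv F (e.symm y) ^ 2 := one_le_pow₀ (hlam.le.trans (hexp _))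
    have h0 := inv_pos.2 (hpos (e.symm y))
    rw [abs_div, abs_neg, abs_mul, abs_of_pos h0, abs_of_pos (pow_pos (hpos _) 2)]
    exact (div_le_self (by positivity) h1).trans (mul_le_mul_of_nonneg_right (hB _) h0.le)

/-- **Existence and uniqueness of the absolutely continuous invariant
probability measure, with `C¹` positive density.** -/
theorem exists_unique_acip
    (F : ℝ → ℝ) (hF : ContDiff ℝ (⊤ : ℕ∞) F) (d : ℤ) (hFlift : ∀ x, F (x + 1) = F x + d)
    (lam : ℝ) (hlam : 1 < lam) (hexp : ∀ x, lam ≤ deriv F x)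
    (fc : UnitAddCircle → UnitAddCircle)
    (hfc : ∀ x : ℝ, fc (x : UnitAddCircle) = ((F x : ℝ) : UnitAddCircle)) :
    ∃ (μ : Measure UnitAddCircle) (ρ : ℝ → ℝ) (hper : Function.Periodic ρ 1),
      IsProbabilityMeasure μ ∧
      (∀ s : Set UnitAddCircle, MeasurableSet s → μ (fc ⁻¹' s) = μ s) ∧
      μ ≪ MeasureTheory.volume ∧
      μ = MeasureTheory.volume.withDensity (fun u => ENNReal.ofReal (hper.lift u)) ∧
      ContDiff ℝ 1 ρ ∧ (∀ x, 0 < ρ x) ∧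
      (∫ x in (0:ℝ)..1, ρ x) = 1 ∧
      (∀ g : ℝ → ℝ, Continuous g → Function.Periodic g 1 →
          (∫ x in (0:ℝ)..1, ρ x * g (F x)) = ∫ x in (0:ℝ)..1, ρ x * g x) ∧
      (∀ ν : Measure UnitAddCircle, IsProbabilityMeasure ν →
          (∀ s : Set UnitAddCircle, MeasurableSet s → ν (fc ⁻¹' s) = ν s) →
          ν ≪ MeasureTheory.volume → ν = μ) := by
  obtain ⟨G, w, w', n, B, hB, h⟩ :=
    exists_expandingInverse (contDiff_infty.1 hF 2) hFlift hlam hexp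
  obtain ⟨a, ha, haB⟩ : ∃ a : ℝ, 1 ≤ a ∧ B + lam⁻¹ * a ≤ a - 1 := by
    have hk : 0 < 1 - lam⁻¹ := sub_pos.2 h.ratio_lt_one
    have hl : 0 < lam⁻¹ := by positivity
    refine ⟨(B + 1) / (1 - lam⁻¹), (one_le_div hk).2 (by linarith), ?_⟩
    have : (1 - lam⁻¹) * ((B + 1) / (1 - lam⁻¹)) = B + 1 := mul_div_cancel₀ _ hk.ne'
    linarith
  have ha0 : 0 < a := by linarith
  obtain ⟨ρ, hρ, hfix⟩ := h.exists_fixed_density ha haB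
  have hpos := hρ.pos ha0
  have hdual {g : ℝ → ℝ} (hg : ∀ a b, IntervalIntegrable g volume a b)
      (hgp : Function.Periodic g 1) :
      ∫ x in (0 : ℝ)..1, ρ x * g (F x) = ∫ x in (0 : ℝ)..1, ρ x * g x := by
    rw [h.integral_mul_comp hρ.continuous hρ.periodic hg hgp, hfix]
  have hfcc : Continuous fc := by
    refine (QuotientAddGroup.isQuotientMap_mk _).continuous_iff.2 ?_
    have : fc ∘ ((↑) : ℝ → UnitAddCircle) = fun x : ℝ => ((F x : ℝ) : UnitAddCircle) :=
      funext hfc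
    exact this ▸ (AddCircle.continuous_mk' 1).comp hF.continuous
  have hindp (s : Set UnitAddCircle) :
      Function.Periodic (fun x : ℝ => s.indicator (1 : UnitAddCircle → ℝ) x) 1 := fun x => by
    simp only [AddCircle.coe_add_period]
  have hindF (s : Set UnitAddCircle) (x : ℝ) :
      (fc ⁻¹' s).indicator (1 : UnitAddCircle → ℝ) x =
        s.indicator (1 : UnitAddCircle → ℝ) (F x : ℝ) := by
    have hmem : (x : UnitAddCircle) ∈ fc ⁻¹' s ↔ ((F x : ℝ) : UnitAddCircle) ∈ s := by
      rw [Set.mem_preimage, hfc]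
    by_cases hx : ((F x : ℝ) : UnitAddCircle) ∈ s <;> simp [Set.indicator, hmem, hx]
  set μ := (volume : Measure UnitAddCircle).withDensity
    (fun u => ENNReal.ofReal (hρ.periodic.lift u)) with hμ
  have hμs {s : Set UnitAddCircle} (hs : MeasurableSet s) := withDensity_lift_apply
    hρ.continuous hρ.periodic hpos hs
  have hprob : IsProbabilityMeasure μ := ⟨by
    rw [hμs MeasurableSet.univ]
    simp [hρ.integral_eq_one]⟩
  have hinv (s : Set UnitAddCircle) (hs : MeasurableSet s) : μ (fc ⁻¹' s) = μ s := by
    rw [hμs hs, hμs (hfcc.measurable hs),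
      ← hdual (intervalIntegrable_indicator_coe hs) (hindp s)]
    simp only [hindF]
  have hmp (ν : Measure UnitAddCircle)
      (hν : ∀ s : Set UnitAddCircle, MeasurableSet s → ν (fc ⁻¹' s) = ν s) :
      MeasurePreserving fc ν ν :=
    ⟨hfcc.measurable, Measure.ext fun s hs => by
      rw [Measure.map_apply hfcc.measurable hs, hν s hs]⟩
  have hac : μ ≪ volume := withDensity_absolutelyContinuous _ _
  have hliftpos (u : UnitAddCircle) : 0 < hρ.periodic.lift u := by
    induction u using QuotientAddGroup.induction_on with
    | H x => exact hpos x
  have hliftc : Continuous hρ.periodic.lift :=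
    (QuotientAddGroup.isQuotientMap_mk _).continuous_iff.2 hρ.continuous
  have hac' : (volume : Measure UnitAddCircle) ≪ μ :=
    withDensity_absolutelyContinuous' (hliftc.measurable.ennreal_ofReal).aemeasurable
      (Filter.Eventually.of_forall fun u => (ENNReal.ofReal_pos.2 (hliftpos u)).ne')
  have herg : Ergodic fc μ := by
    refine ⟨hmp μ hinv, ⟨fun s hs hfs => ?_⟩⟩
    set m := ∫ x in (0 : ℝ)..1, ρ x * s.indicator (1 : UnitAddCircle → ℝ) x with hm
    have hgi := intervalIntegrable_indicator_coe hs
    have hg1 (u : UnitAddCircle) : |s.indicator (1 : UnitAddCircle → ℝ) u| ≤ 1 := by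
      by_cases hu : u ∈ s <;> simp [hu]
    have hconst : (fun u => s.indicator (1 : UnitAddCircle → ℝ) u - m) =ᵐ[volume] 0 := by
      refine ae_eq_zero_of_forall_integral_mul_eq_zero
        ((measurable_one.indicator hs).sub_const m) (C := 1 + |m|)
        (fun u => (abs_sub _ _).trans (by linarith [hg1 u])) fun φ hφ hφp => ?_
      obtain ⟨K, hK, hφK⟩ := exists_logLipschitzDensity_add_const ha0 hφ hφp
      have hcomp := h.integral_mul_eq_of_invariant ha haB hφK hρ hgi (fun x => hg1 x) (hindp s)
        fun x => by rw [← hindF s x, hfs]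
      have hcomp1 := h.integral_mul_eq_of_invariant ha haB (LogLipschitzDensity.one ha0) hρ hgi
        (fun x => hg1 x) (hindp s) fun x => by rw [← hindF s x, hfs]
      simp only [mul_assoc, intervalIntegral.integral_const_mul, add_mul, one_mul] at hcomp hcomp1
      rw [intervalIntegral.integral_add ((hgi 0 1).continuousOn_mul hφ.continuous.continuousOn)
        ((hgi 0 1).const_mul K), intervalIntegral.integral_const_mul, hcomp1, ← hm,
        inv_mul_eq_iff_eq_mul₀ hK.ne'] at hcomp
      simp only [mul_sub]
      rw [intervalIntegral.integral_sub ((hgi 0 1).continuousOn_mul hφ.continuous.continuousOn)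
        ((hφ.continuous.mul_const m).intervalIntegrable _ _),
        intervalIntegral.integral_mul_const]
      linarith
    rw [Filter.eventuallyConst_set]
    replace hconst := hac.ae_le hconst
    by_cases h0 : m = 0
    · right
      filter_upwards [hconst] with u hu hus
      simp [hus, h0] at hu
    · left
      filter_upwards [hconst] with u hu
      by_contra hus
      simp [hus, h0] at hu
  exact ⟨μ, ρ, hρ.periodic, hprob, hinv, hac, rfl, hρ.contDiff, hpos, hρ.integral_eq_one,
    fun g hg hgp => hdual (fun a b => hg.intervalIntegrable a b) hgp,
    fun ν _ hν hνv => herg.eq_of_absolutelyContinuous (hmp ν hν) (hνv.trans hac')⟩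

end
end
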